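/- arXiv:2307.05712 — 3 statements merged into one kernel-verified Lean document; each statement's English description precedes it below -/
import Mathlib

section
/- Let F(x,y) = H(x,y)² G_4(x,y) + H(x,y) G_3(x,y) + F_2(x,y) + F_1(x,y) ∈ ℤ[x,y], where H is a primitive integral linear form, G_4 and G_3 are integral binary quadratic forms with H dividing neither G_4 nor G_3, there is no primitive integral linear form L, not dividing H, with L² dividing G_3, the degree-4 part H²G_4 is positive semi-definite, and F_2, F_1 are arbitrary integral forms of degrees 2 and 1 (possibly zero). Then either there exists λ > 0 such that #ℛ_F([N,2N]) ≪ N^{1−λ}, or the infimum of F(x,y) over (x,y) ∈ ℤ² is −∞. -/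
/-- Evaluation of an integer polynomial in two variables at a real point. -/
noncomputable def evalReal (G : MvPolynomial (Fin 2) ℤ) (x y : ℝ) : ℝ :=
  MvPolynomial.aeval ![x, y] G

/-- Positive semi-definite: nonnegative at every real point. -/
def PosSemidef2 (G : MvPolynomial (Fin 2) ℤ) : Prop :=
  ∀ x y : ℝ, 0 ≤ evalReal G x y

/-- A primitive integral polynomial: the gcd of its coefficients is a unit. -/
def IsPrimitiveInt (G : MvPolynomial (Fin 2) ℤ) : Prop :=
  ∀ d : ℤ, (∀ m, d ∣ MvPolynomial.coeff m G) → IsUnit d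

lemma qcl_cubic (p q r M : ℤ) (h : ∀ t : ℤ, -M ≤ p * t ^ 3 + q * t ^ 2 + r * t) : p = 0 := by
  by_contra hp
  obtain ⟨T, hT⟩ : ∃ T : ℤ, T = |q| + |r| + |M| + 1 := ⟨_, rfl⟩
  have hq := abs_nonneg q
  have hr := abs_nonneg r
  have hM := abs_nonneg M
  have hT1 : 1 ≤ T := by omega
  have key : ∀ s : ℤ, (s = 1 ∨ s = -1) → 1 ≤ p * s → False := by
    intro s hs hps
    have h1 := h (-s * T)
    have e : p * (-s * T) ^ 3 + q * (-s * T) ^ 2 + r * (-s * T)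
        = -(p * s) * T ^ 3 + q * T ^ 2 - (r * s) * T := by
      rcases hs with rfl | rfl <;> ring
    rw [e] at h1
    have hrs : -(r * s) ≤ |r| := by
      rcases hs with rfl | rfl
      · have := neg_abs_le r; linarith
      · have := le_abs_self r; linarith
    have hq' := le_abs_self q
    have hM' := le_abs_self M
    have h2 : (1:ℤ) ≤ T ^ 2 := by nlinarith
    have a1 : (p * s) * T ^ 3 ≥ T ^ 3 := by
      have : 0 ≤ T ^ 3 := by positivity
      exact le_mul_of_one_le_left this hps
    have a2 : q * T ^ 2 ≤ |q| * T ^ 2 := mul_le_mul_of_nonneg_right hq' (by linarith)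
    have a3 : -(r * s) * T ≤ |r| * T ^ 2 := by
      have : -(r * s) * T ≤ |r| * T := by nlinarith
      have : |r| * T ≤ |r| * T ^ 2 := by
        apply mul_le_mul_of_nonneg_left _ hr
        nlinarith
      linarith
    have a4 : T ^ 3 = (|q| + |r| + |M| + 1) * T ^ 2 := by rw [← hT]; ring
    have a5 : |M| + 1 ≤ (|M| + 1) * T ^ 2 := le_mul_of_one_le_right (by omega) h2
    linarith
  rcases lt_or_gt_of_ne hp with h1 | h1
  · exact key (-1) (Or.inr rfl) (by omega)
  · exact key 1 (Or.inl rfl) (by omega)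

lemma qcl_quad (α β γ M : ℤ) (h : ∀ t : ℤ, -M ≤ α * t ^ 2 + β * t + γ) :
    0 < α ∨ (α = 0 ∧ β = 0) := by
  by_contra hcon
  push Not at hcon
  obtain ⟨h1, h2⟩ := hcon
  set T : ℤ := |β| + |γ| + |M| + 1 with hT
  have hq := abs_nonneg β
  have hr := abs_nonneg γ
  have hM := abs_nonneg M
  have hγ := le_abs_self γ
  have hβ := le_abs_self β
  have hM' := le_abs_self M
  have hT1 : 1 ≤ T := by omega
  rcases lt_or_eq_of_le h1 with h1 | h1
  · have := h T
    have a1 : α * T ^ 2 ≤ - T ^ 2 := by nlinarith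
    have a2 : β * T ≤ |β| * T := by nlinarith
    have a4 : T ^ 2 = (|β| + |γ| + |M| + 1) * T := by rw [← hT]; ring
    nlinarith
  · have hb := h2 h1
    subst h1
    rcases lt_or_gt_of_ne hb with hb | hb
    · have := h T
      nlinarith
    · have := h (-T)
      nlinarith

lemma qcl_interval (S : Set ℤ) (s : ℕ) (h : ∀ x ∈ S, ∀ y ∈ S, x < y → y - x ≤ s) :
    S.Finite ∧ S.ncard ≤ s + 1 := by
  rcases S.eq_empty_or_nonempty with rfl | ⟨y0, hy0⟩
  · simp
  have hb : ∀ z, z ∈ S → y0 - s ≤ z := by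
    intro z hz
    rcases lt_or_ge z y0 with h1 | h1
    · have := h z hz y0 hy0 h1; omega
    · omega
  obtain ⟨l, hl, hmin⟩ := Int.exists_least_of_bdd (P := fun z => z ∈ S) ⟨_, hb⟩ ⟨y0, hy0⟩
  have hsub : S ⊆ ↑(Finset.Icc l (l + s)) := by
    intro z hz
    have h1 := hmin z hz
    simp only [Finset.coe_Icc, Set.mem_Icc]
    refine ⟨h1, ?_⟩
    rcases lt_or_eq_of_le h1 with h2 | h2
    · have := h l hl z hz h2; omega
    · omega
  refine ⟨(Finset.finite_toSet _).subset hsub, ?_⟩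
  have := Set.ncard_le_ncard hsub (Finset.finite_toSet _)
  rw [Set.ncard_coe_finset, Int.card_Icc] at this
  omega

lemma qcl_roots (α β γ : ℤ) (A : ℕ) (hα : 0 < α) :
    {n : ℤ | (A : ℤ) ≤ α * n ^ 2 + β * n + γ ∧ α * n ^ 2 + β * n + γ ≤ 2 * A}.Finite ∧
    {n : ℤ | (A : ℤ) ≤ α * n ^ 2 + β * n + γ ∧ α * n ^ 2 + β * n + γ ≤ 2 * A}.ncard
      ≤ 2 * Nat.sqrt A + 2 := by
  set S := {n : ℤ | (A : ℤ) ≤ α * n ^ 2 + β * n + γ ∧ α * n ^ 2 + β * n + γ ≤ 2 * A} with hS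
  have sq : ∀ d : ℤ, 0 < d → d ^ 2 ≤ A → d ≤ Nat.sqrt A := by
    intro d hd h
    lift d to ℕ using hd.le
    norm_cast at *
    rw [Nat.le_sqrt']; exact h
  have h1 := qcl_interval {n | n ∈ S ∧ 0 ≤ 2 * α * n + β} (Nat.sqrt A) (by
    rintro x ⟨⟨hx1, hx2⟩, hx3⟩ y ⟨⟨hy1, hy2⟩, hy3⟩ hxy
    apply sq _ (by omega)
    have e : (α * y ^ 2 + β * y + γ) - (α * x ^ 2 + β * x + γ)
      = α * (y - x) ^ 2 + (2 * α * x + β) * (y - x) := by ring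
    have : 0 ≤ (2 * α * x + β) * (y - x) := mul_nonneg hx3 (by omega)
    nlinarith [sq_nonneg (y - x)])
  have h2 := qcl_interval {n | n ∈ S ∧ 2 * α * n + β ≤ 0} (Nat.sqrt A) (by
    rintro x ⟨⟨hx1, hx2⟩, hx3⟩ y ⟨⟨hy1, hy2⟩, hy3⟩ hxy
    apply sq _ (by omega)
    have e : (α * x ^ 2 + β * x + γ) - (α * y ^ 2 + β * y + γ)
      = α * (y - x) ^ 2 + -(2 * α * y + β) * (y - x) := by ring
    have : 0 ≤ -(2 * α * y + β) * (y - x) := mul_nonneg (by omega) (by omega)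
    nlinarith [sq_nonneg (y - x)])
  have hu : S ⊆ {n | n ∈ S ∧ 0 ≤ 2 * α * n + β} ∪ {n | n ∈ S ∧ 2 * α * n + β ≤ 0} := by
    intro n hn
    rcases le_total 0 (2 * α * n + β) with h | h
    · exact Or.inl ⟨hn, h⟩
    · exact Or.inr ⟨hn, h⟩
  have hfin := h1.1.union h2.1
  refine ⟨hfin.subset hu, ?_⟩
  have := Set.ncard_le_ncard hu hfin
  have := Set.ncard_union_le {n | n ∈ S ∧ 0 ≤ 2 * α * n + β} {n | n ∈ S ∧ 2 * α * n + β ≤ 0}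
  omega

lemma qcl_row (α β γ : ℤ) (κ N : ℕ) (hκ : 1 ≤ κ) (hN : 1 ≤ N)
    (h : 0 < α ∨ (α = 0 ∧ β = 0)) (V : Set ℤ)
    (hV : ∀ m ∈ V, (N : ℤ) ≤ m ∧ m ≤ 2 * N ∧ ∃ n, α * n ^ 2 + β * n + γ = κ * m) :
    (V.ncard : ℝ) ≤ 4 * κ * Real.sqrt N := by
  have hN' : (1:ℝ) ≤ Real.sqrt N := by
    rw [Real.one_le_sqrt]; exact_mod_cast hN
  have hκ' : (1:ℝ) ≤ κ := by exact_mod_cast hκ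
  have hκz : (1:ℤ) ≤ κ := by exact_mod_cast hκ
  rcases h with h | ⟨rfl, rfl⟩
  · obtain ⟨hf, hc⟩ := qcl_roots α β γ (κ * N) h
    set S := {n : ℤ | ((κ * N : ℕ) : ℤ) ≤ α * n ^ 2 + β * n + γ ∧
      α * n ^ 2 + β * n + γ ≤ 2 * (κ * N : ℕ)} with hS
    have hsub : V ⊆ (fun n : ℤ => (α * n ^ 2 + β * n + γ) / κ) '' S := by
      intro m hm
      obtain ⟨h1, h2, n, hn⟩ := hV m hm
      refine ⟨n, ⟨?_, ?_⟩, ?_⟩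
      · rw [hn]; push_cast; nlinarith
      · rw [hn]; push_cast; nlinarith
      · simp only [hn]; exact Int.mul_ediv_cancel_left _ (by omega)
    have h1 := Set.ncard_le_ncard hsub (hf.image _)
    have h2 := Set.ncard_image_le (f := fun n : ℤ => (α * n ^ 2 + β * n + γ) / κ) hf
    have h3 : (V.ncard : ℝ) ≤ 2 * (Nat.sqrt (κ * N) : ℝ) + 2 := by
      exact_mod_cast (h1.trans h2).trans hc
    have h4 : (Nat.sqrt (κ * N) : ℝ) ≤ κ * Real.sqrt N := by
      have a : (Nat.sqrt (κ * N) : ℝ) ≤ Real.sqrt ((κ * N : ℕ) : ℝ) := Real.nat_sqrt_le_real_sqrt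
      have b : Real.sqrt ((κ * N : ℕ) : ℝ) ≤ κ * Real.sqrt N := by
        push_cast
        rw [Real.sqrt_mul (by positivity)]
        apply mul_le_mul_of_nonneg_right _ (by positivity)
        rw [Real.sqrt_le_left (by positivity)]
        nlinarith
      linarith
    nlinarith
  · have : V.ncard ≤ 1 := by
      have hfin : V.Finite := (Set.finite_Icc (N : ℤ) (2 * N)).subset
        fun m hm => ⟨(hV m hm).1, (hV m hm).2.1⟩
      rw [Set.ncard_le_one hfin]
      intro a ha b hb
      obtain ⟨_, _, n, hn⟩ := hV a ha
      obtain ⟨_, _, n', hn'⟩ := hV b hb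
      have : (κ : ℤ) * a = κ * b := by rw [← hn, ← hn']; ring
      exact mul_left_cancel₀ (by omega) this
    have h3 : (V.ncard : ℝ) ≤ 1 := by exact_mod_cast this
    nlinarith

lemma qcl_count (F Z : ℤ → ℤ → ℤ) (K1 K2 : ℝ) (hK1 : 0 ≤ K1) (hK2 : 0 ≤ K2) (N : ℕ) (hN : 1 ≤ N)
    (h1 : ∀ x, (({m : ℤ | (N : ℤ) ≤ m ∧ m ≤ 2 * N ∧ ∃ y, F x y = m}).ncard : ℝ)
      ≤ K1 * Real.sqrt N)
    (h2 : ∀ z, (({m : ℤ | (N : ℤ) ≤ m ∧ m ≤ 2 * N ∧ ∃ x y, Z x y = z ∧ F x y = m}).ncard : ℝ)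
      ≤ K1 * Real.sqrt N)
    (h3 : ∀ x y, (N : ℤ) ≤ F x y → F x y ≤ 2 * N →
      (x : ℝ) ^ 4 ≤ K2 * N ∨ (Z x y : ℝ) ^ 4 ≤ K2 * N) :
    (({m : ℤ | (N : ℤ) ≤ m ∧ m ≤ 2 * N ∧ ∃ x y, F x y = m}).ncard : ℝ)
      ≤ (6 * (K2 + 1) * K1 + 1) * (N : ℝ) ^ (1 - (1 / 4) : ℝ) := by
  have hNr : (1:ℝ) ≤ N := by exact_mod_cast hN
  set R : ℝ := (N : ℝ) ^ (1 / 4 : ℝ) with hR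
  have hR1 : 1 ≤ R := Real.one_le_rpow hNr (by norm_num)
  have hR4 : R ^ 4 = N := by
    rw [hR, ← Real.rpow_natCast, ← Real.rpow_mul (by positivity)]; norm_num
  have hs : Real.sqrt N = R ^ 2 := by
    rw [← hR4, show R ^ 4 = (R ^ 2) ^ 2 by ring, Real.sqrt_sq (by positivity)]
  have hR3 : (N : ℝ) ^ (1 - (1 / 4) : ℝ) = R ^ 3 := by
    rw [hR, ← Real.rpow_natCast, ← Real.rpow_mul (by positivity)]; norm_num
  set B : ℕ := ⌊(K2 + 1) * R⌋₊ with hB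
  have hBle : (B : ℝ) ≤ (K2 + 1) * R := Nat.floor_le (by positivity)
  have hin : ∀ x : ℤ, (x : ℝ) ^ 4 ≤ K2 * N → x ∈ Finset.Icc (-(B : ℤ)) B := by
    intro x hx
    rw [← hR4] at hx
    have : |(x : ℝ)| ≤ (K2 + 1) * R := by
      apply le_of_pow_le_pow_left₀ (n := 4) (by norm_num) (by positivity)
      rw [show |(x : ℝ)| ^ 4 = (x : ℝ) ^ 4 from Even.pow_abs ⟨2, rfl⟩ _, mul_pow]
      refine hx.trans (mul_le_mul_of_nonneg_right ?_ (by positivity))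
      have : K2 + 1 ≤ (K2 + 1) ^ 4 := le_self_pow₀ (by linarith) (by norm_num)
      linarith
    have h5 : x.natAbs ≤ B := by
      apply Nat.le_floor
      rw [Nat.cast_natAbs]; push_cast; exact this
    rw [Finset.mem_Icc]; omega
  set I := Finset.Icc (-(B : ℤ)) B with hI
  have hcard : (I.card : ℝ) ≤ 3 * (K2 + 1) * R := by
    have : I.card = 2 * B + 1 := by rw [hI, Int.card_Icc]; omega
    rw [this]; push_cast
    nlinarith
  set V1 : ℤ → Set ℤ := fun x => {m : ℤ | (N : ℤ) ≤ m ∧ m ≤ 2 * N ∧ ∃ y, F x y = m} with hV1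
  set V2 : ℤ → Set ℤ := fun z =>
    {m : ℤ | (N : ℤ) ≤ m ∧ m ≤ 2 * N ∧ ∃ x y, Z x y = z ∧ F x y = m} with hV2
  have hsub : {m : ℤ | (N : ℤ) ≤ m ∧ m ≤ 2 * N ∧ ∃ x y, F x y = m} ⊆
      (⋃ x ∈ I, V1 x) ∪ (⋃ z ∈ I, V2 z) := by
    rintro m ⟨a, b, x, y, rfl⟩
    rcases h3 x y a b with h | h
    · left; simp only [Set.mem_iUnion]
      exact ⟨x, hin _ h, a, b, y, rfl⟩
    · right; simp only [Set.mem_iUnion]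
      exact ⟨_, hin _ h, a, b, x, y, rfl, rfl⟩
  have hfin : ((⋃ x ∈ I, V1 x) ∪ (⋃ z ∈ I, V2 z)).Finite := by
    apply (Set.finite_Icc (N : ℤ) (2 * N)).subset
    intro m hm
    simp only [Set.mem_union, Set.mem_iUnion] at hm
    rcases hm with ⟨x, _, a, b, _⟩ | ⟨x, _, a, b, _⟩ <;> exact ⟨a, b⟩
  have c1 := Set.ncard_le_ncard hsub hfin
  have c2 := Set.ncard_union_le (⋃ x ∈ I, V1 x) (⋃ z ∈ I, V2 z)
  have gen : ∀ V : ℤ → Set ℤ, (∀ x, ((V x).ncard : ℝ) ≤ K1 * Real.sqrt N) →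
      ((⋃ x ∈ I, V x).ncard : ℝ) ≤ I.card * (K1 * Real.sqrt N) := by
    intro V hV
    have := Finset.set_ncard_biUnion_le I V
    calc ((⋃ x ∈ I, V x).ncard : ℝ) ≤ ((∑ i ∈ I, (V i).ncard : ℕ) : ℝ) := by exact_mod_cast this
      _ = ∑ i ∈ I, ((V i).ncard : ℝ) := by push_cast; rfl
      _ ≤ ∑ i ∈ I, (K1 * Real.sqrt N) := Finset.sum_le_sum fun i _ => hV i
      _ = _ := by simp
  have g1 := gen V1 h1
  have g2 := gen V2 h2
  have c3 : ({m : ℤ | (N : ℤ) ≤ m ∧ m ≤ 2 * N ∧ ∃ x y, F x y = m}.ncard : ℝ) ≤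
      ((⋃ x ∈ I, V1 x).ncard : ℝ) + ((⋃ z ∈ I, V2 z).ncard : ℝ) := by
    exact_mod_cast c1.trans c2
  rw [hR3]
  rw [hs] at g1 g2
  have : (I.card : ℝ) * (K1 * R ^ 2) ≤ 3 * (K2 + 1) * R * (K1 * R ^ 2) :=
    mul_le_mul_of_nonneg_right hcard (by positivity)
  have : 0 ≤ R ^ 3 := by positivity
  nlinarith

/-- The quartic function in normalised coordinates. -/
def qclF (a b c d e f g h k l m x y : ℤ) : ℤ :=
  x ^ 2 * (a * x ^ 2 + b * x * y + c * y ^ 2) + x * (d * x ^ 2 + e * x * y + f * y ^ 2)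
    + (g * x ^ 2 + h * x * y + k * y ^ 2) + (l * x + m * y)

lemma qcl_term (T p u v : ℝ) (hp : |p| ≤ T) (hu : |u| ≤ v) : -(T * v) ≤ p * u := by
  have : |p * u| ≤ T * v := by
    rw [abs_mul]; exact mul_le_mul hp hu (abs_nonneg _) ((abs_nonneg _).trans hp)
  linarith [neg_abs_le (p * u)]

lemma qcl_grow1 (T X W : ℝ) (hT : 1 ≤ T) (hX : 14 * T ≤ X) (hW : 0 ≤ W) :
    X ^ 4 / 2 ≤ X ^ 2 * W ^ 2 + X ^ 4 - T * (X ^ 3 + X ^ 2 * W + X * W ^ 2 + X ^ 2 + X * W + W ^ 2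
      + X + W) := by
  have hX1 : 1 ≤ X := by linarith
  have hs : X ^ 3 + X ^ 2 * W + X * W ^ 2 + X ^ 2 + X * W + W ^ 2 + X + W ≤
      7 * (X ^ 3 + X * W ^ 2) := by
    have t0 : X ^ 2 ≤ X ^ 3 := by nlinarith [sq_nonneg X]
    have t1 : X ≤ X ^ 2 := by nlinarith
    have t2 : W ^ 2 ≤ X * W ^ 2 := by nlinarith [sq_nonneg W]
    have t3 : 2 * (X * W) ≤ X ^ 2 + W ^ 2 := by nlinarith [sq_nonneg (X - W)]
    have t4 : 2 * (X ^ 2 * W) ≤ X ^ 3 + X * W ^ 2 := by nlinarith [sq_nonneg (X - W)]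
    have t5 : 2 * W ≤ W ^ 2 + 1 := by nlinarith [sq_nonneg (W - 1)]
    nlinarith [sq_nonneg W]
  have hp : 0 ≤ X ^ 3 + X * W ^ 2 := by positivity
  have h2 : 14 * T * (X ^ 3 + X * W ^ 2) ≤ X * (X ^ 3 + X * W ^ 2) :=
    mul_le_mul_of_nonneg_right hX hp
  have h3 := mul_le_mul_of_nonneg_left hs (by linarith : 0 ≤ T)
  have : 0 ≤ X ^ 2 * W ^ 2 := by positivity
  nlinarith

lemma qcl_grow2 (T X W : ℝ) (hT : 1 ≤ T) (hX : 14 * T ≤ X) (hW : 14 * T ≤ W) :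
    X ^ 2 * W ^ 2 / 2 ≤ X ^ 2 * W ^ 2 - T * (X ^ 2 * W + X * W ^ 2 + X ^ 2 + X * W + W ^ 2
      + X + W) := by
  have hX1 : 1 ≤ X := by linarith
  have hW1 : 1 ≤ W := by linarith
  have key : ∀ u : ℝ, u ≤ X * W ^ 2 ∨ u ≤ X ^ 2 * W → 14 * T * u ≤ X ^ 2 * W ^ 2 := by
    intro u hu
    rcases hu with hu | hu
    · have h1 : 14 * T * u ≤ 14 * T * (X * W ^ 2) := mul_le_mul_of_nonneg_left hu (by linarith)
      have h2 : 14 * T * (X * W ^ 2) ≤ X * (X * W ^ 2) :=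
        mul_le_mul_of_nonneg_right hX (by positivity)
      nlinarith
    · have h1 : 14 * T * u ≤ 14 * T * (X ^ 2 * W) := mul_le_mul_of_nonneg_left hu (by linarith)
      have h2 : 14 * T * (X ^ 2 * W) ≤ W * (X ^ 2 * W) :=
        mul_le_mul_of_nonneg_right hW (by positivity)
      nlinarith
  have XX : X ≤ X ^ 2 := by nlinarith
  have WW : W ≤ W ^ 2 := by nlinarith
  have k1 := key (X ^ 2 * W) (Or.inr le_rfl)
  have k2 := key (X * W ^ 2) (Or.inl le_rfl)
  have k3 := key (X ^ 2) (Or.inr (le_mul_of_one_le_right (by positivity) hW1))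
  have k4 := key (X * W) (Or.inl (mul_le_mul_of_nonneg_left WW (by positivity)))
  have k5 := key (W ^ 2) (Or.inl (le_mul_of_one_le_left (by positivity) hX1))
  have k6 := key X (Or.inr (XX.trans (le_mul_of_one_le_right (by positivity) hW1)))
  have k7 := key W (Or.inl (WW.trans (le_mul_of_one_le_left (by positivity) hX1)))
  linarith

lemma qcl_pow4 (T K x : ℝ) (hT : 1 ≤ T) (hx : (14 * T) ^ 4 * K < x ^ 4) (hK : 1 ≤ K) :
    14 * T ≤ |x| := by
  by_contra hcon
  push Not at hcon
  have h1 : |x| ^ 4 ≤ (14 * T) ^ 4 := pow_le_pow_left₀ (abs_nonneg _) hcon.le 4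
  rw [show |x| ^ 4 = x ^ 4 from Even.pow_abs ⟨2, rfl⟩ _] at h1
  have : (14 * T) ^ 4 ≤ (14 * T) ^ 4 * K := le_mul_of_one_le_right (by positivity) hK
  linarith

/-- growth of the transformed function -/
lemma qcl_iii (c δ q e f q2 h k l m : ℝ) (hc : 1 ≤ c) (hcase : 1 ≤ δ ∨ (δ = 0 ∧ q = 0)) (κ : ℝ)
    (hκ : 1 ≤ κ) :
    ∃ K2 : ℝ, 0 ≤ K2 ∧ ∀ (N x w : ℝ), 1 ≤ N →
      c * x ^ 2 * w ^ 2 + c * δ * x ^ 4 + q * x ^ 3 + e * (x ^ 2 * w) + f * (x * w ^ 2) + q2 * x ^ 2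
        + h * (x * w) + k * w ^ 2 + l * x + m * w ≤ κ * (2 * N) →
      x ^ 4 ≤ K2 * N ∨ ((δ = 0 ∧ q = 0) ∧ w ^ 4 ≤ K2 * N) := by
  obtain ⟨T, hT⟩ : ∃ T : ℝ, T = 1 + |q| + |e| + |f| + |q2| + |h| + |k| + |l| + |m| := ⟨_, rfl⟩
  have p1 := abs_nonneg q
  have p2 := abs_nonneg e
  have p3 := abs_nonneg f
  have p4 := abs_nonneg q2
  have p5 := abs_nonneg h
  have p6 := abs_nonneg k
  have p7 := abs_nonneg l
  have p8 := abs_nonneg m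
  have hT1 : 1 ≤ T := by linarith
  refine ⟨(14 * T) ^ 4 + 4 * κ, by positivity, ?_⟩
  intro N x w hN hle
  by_contra hcon
  push Not at hcon
  obtain ⟨hx, hw⟩ := hcon
  have a2 := qcl_term T e (x ^ 2 * w) (|x| ^ 2 * |w|) (by linarith) (by simp [abs_mul])
  have a3 := qcl_term T f (x * w ^ 2) (|x| * |w| ^ 2) (by linarith) (by simp [abs_mul])
  have a4 := qcl_term T q2 (x ^ 2) (|x| ^ 2) (by linarith) (by simp)
  have a5 := qcl_term T h (x * w) (|x| * |w|) (by linarith) (by simp [abs_mul])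
  have a6 := qcl_term T k (w ^ 2) (|w| ^ 2) (by linarith) (by simp)
  have a7 := qcl_term T l x (|x|) (by linarith) le_rfl
  have a8 := qcl_term T m w (|w|) (by linarith) le_rfl
  have e4 : ∀ x : ℝ, |x| ^ 4 = x ^ 4 := fun x => Even.pow_abs ⟨2, rfl⟩ _
  have e2 : |x| ^ 2 * |w| ^ 2 = x ^ 2 * w ^ 2 := by rw [sq_abs, sq_abs]
  have hxw : |x| ^ 2 * |w| ^ 2 ≤ c * x ^ 2 * w ^ 2 := by
    rw [e2, mul_assoc]; exact le_mul_of_one_le_left (by positivity) hc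
  have big : ∀ x : ℝ, ((14 * T) ^ 4 + 4 * κ) * N < x ^ 4 → 14 * T ≤ |x| ∧ 4 * κ * N < x ^ 4 := by
    intro x hx
    have : 0 ≤ (14 * T) ^ 4 * N := by positivity
    have : 0 ≤ 4 * κ * N := by positivity
    exact ⟨qcl_pow4 T N x hT1 (by linarith) hN, by linarith⟩
  obtain ⟨hx1, hx2⟩ := big x hx
  rcases hcase with hδ | h0
  · have a1 := qcl_term T q (x ^ 3) (|x| ^ 3) (by linarith) (by simp)
    have := qcl_grow1 T |x| |w| hT1 hx1 (abs_nonneg _)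
    have b : |x| ^ 4 ≤ c * δ * x ^ 4 := by
      rw [e4]; exact le_mul_of_one_le_left (by positivity) (by nlinarith)
    have := e4 x
    linarith
  · obtain ⟨hw1, hw2⟩ := big w (hw h0)
    have := qcl_grow2 T |x| |w| hT1 hx1 hw1
    obtain ⟨rfl, rfl⟩ := h0
    have : 4 * κ * N < |x| ^ 2 * |w| ^ 2 := by
      rw [e2]
      apply lt_of_pow_lt_pow_left₀ 2 (by positivity)
      calc (4 * κ * N) ^ 2 = (4 * κ * N) * (4 * κ * N) := by ring
        _ < x ^ 4 * w ^ 4 := mul_lt_mul'' hx2 hw2 (by positivity) (by positivity)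
        _ = _ := by ring
    linarith

lemma qcl_core (a b c d e f g h k l m : ℤ) (hc : 0 < c) (hb : b ^ 2 ≤ 4 * a * c) (M : ℤ)
    (hM : ∀ x y, -M ≤ qclF a b c d e f g h k l m x y) :
    ∃ C : ℝ, 0 < C ∧ ∀ N : ℕ, 1 ≤ N →
      (({n : ℤ | (N : ℤ) ≤ n ∧ n ≤ 2 * N ∧ ∃ x y, qclF a b c d e f g h k l m x y = n}).ncard : ℝ)
      ≤ C * (N : ℝ) ^ (1 - (1 / 4) : ℝ) := by
  obtain ⟨δ, hδ⟩ : ∃ δ : ℤ, δ = 4 * a * c - b ^ 2 := ⟨_, rfl⟩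
  obtain ⟨q, hq⟩ : ∃ q : ℤ, q = 4 * c ^ 2 * d - 2 * b * c * e + b ^ 2 * f := ⟨_, rfl⟩
  obtain ⟨κ, hκ⟩ : ∃ κ : ℕ, (κ : ℤ) = 4 * c ^ 2 :=
    ⟨(4 * c ^ 2).toNat, Int.toNat_of_nonneg (by positivity)⟩
  have hκ1 : 1 ≤ κ := by
    have : (1:ℤ) ≤ κ := by rw [hκ]; nlinarith
    exact_mod_cast this
  obtain ⟨e', he'⟩ : ∃ r : ℤ, r = 2 * c * e - 2 * b * f := ⟨_, rfl⟩
  obtain ⟨q2, hq2⟩ : ∃ r : ℤ, r = 4 * c ^ 2 * g - 2 * b * c * h + b ^ 2 * k := ⟨_, rfl⟩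
  obtain ⟨h', hh'⟩ : ∃ r : ℤ, r = 2 * c * h - 2 * b * k := ⟨_, rfl⟩
  obtain ⟨l', hl'⟩ : ∃ r : ℤ, r = 4 * c ^ 2 * l - 2 * b * c * m := ⟨_, rfl⟩
  obtain ⟨m', hm'⟩ : ∃ r : ℤ, r = 2 * c * m := ⟨_, rfl⟩
  -- the master identity
  have master : ∀ x y : ℤ, (κ : ℤ) * qclF a b c d e f g h k l m x y =
      c * x ^ 2 * (b * x + 2 * c * y) ^ 2 + c * δ * x ^ 4 + q * x ^ 3
        + e' * (x ^ 2 * (b * x + 2 * c * y)) + f * (x * (b * x + 2 * c * y) ^ 2) + q2 * x ^ 2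
        + h' * (x * (b * x + 2 * c * y)) + k * (b * x + 2 * c * y) ^ 2 + l' * x
        + m' * (b * x + 2 * c * y) := by
    intro x y
    rw [hκ, hδ, hq, he', hq2, hh', hl', hm']
    unfold qclF
    ring
  have hcase : 1 ≤ δ ∨ (δ = 0 ∧ q = 0) := by
    rcases lt_or_eq_of_le (show 0 ≤ δ by rw [hδ]; linarith) with h1 | h1
    · left; omega
    · right
      refine ⟨h1.symm, ?_⟩
      have := qcl_cubic (2 * c * q) (q2) (2 * c * l - b * m) M (by
        intro t
        have e1 := hM (2 * c * t) (-b * t)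
        have e2 : qclF a b c d e f g h k l m (2 * c * t) (-b * t) =
          2 * c * q * t ^ 3 + q2 * t ^ 2 + (2 * c * l - b * m) * t + 4 * c ^ 3 * δ * t ^ 4 := by
          rw [hδ, hq, hq2]; unfold qclF; ring
        rw [e2, ← h1] at e1
        linarith)
      rcases mul_eq_zero.1 this with h2 | h2
      · omega
      · exact h2
  have hcr : (1:ℝ) ≤ c := by exact_mod_cast hc
  have hcaser : (1:ℝ) ≤ δ ∨ ((δ:ℝ) = 0 ∧ (q:ℝ) = 0) := by exact_mod_cast hcase
  obtain ⟨K2, hK2, hiii⟩ := qcl_iii c δ q e' f q2 h' k l' m' hcr hcaser κ (by exact_mod_cast hκ1)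
  have row : ∀ N : ℕ, 1 ≤ N → ∀ x, (({n : ℤ | (N : ℤ) ≤ n ∧ n ≤ 2 * N ∧
      ∃ y, qclF a b c d e f g h k l m x y = n}).ncard : ℝ) ≤ 4 * κ * Real.sqrt N := by
    intro N hN x
    have hq := qcl_quad (c * x ^ 2 + f * x + k) (b * x ^ 3 + e * x ^ 2 + h * x + m)
      (a * x ^ 4 + d * x ^ 3 + g * x ^ 2 + l * x) M (by
        intro y
        have := hM x y
        unfold qclF at this
        linarith)
    have h1 := qcl_row _ _ (a * x ^ 4 + d * x ^ 3 + g * x ^ 2 + l * x) 1 N le_rfl hN hq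
      {n : ℤ | (N : ℤ) ≤ n ∧ n ≤ 2 * N ∧ ∃ y, qclF a b c d e f g h k l m x y = n} (by
        rintro n ⟨h1, h2, y, rfl⟩
        refine ⟨h1, h2, y, ?_⟩
        unfold qclF; push_cast; ring)
    refine h1.trans ?_
    have : (1:ℝ) ≤ κ := by exact_mod_cast hκ1
    have := Real.sqrt_nonneg (N : ℝ)
    push_cast
    nlinarith
  have hpos : 0 < 6 * (K2 + 1) * (4 * (κ : ℝ)) + 1 := by positivity
  refine ⟨_, hpos, ?_⟩
  intro N hN
  have hNr : (1:ℝ) ≤ N := by exact_mod_cast hN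
  have hgr : ∀ x y : ℤ, qclF a b c d e f g h k l m x y ≤ 2 * N →
      (x : ℝ) ^ 4 ≤ K2 * N ∨ (((δ:ℝ) = 0 ∧ (q:ℝ) = 0) ∧
        ((b * x + 2 * c * y : ℤ) : ℝ) ^ 4 ≤ K2 * N) := by
    intro x y hle
    apply hiii N x _ hNr
    have h1 : (κ : ℤ) * qclF a b c d e f g h k l m x y ≤ κ * (2 * N) :=
      mul_le_mul_of_nonneg_left hle (by positivity)
    rw [master] at h1
    exact_mod_cast h1
  rcases hcase with h1 | ⟨hd0, hq0⟩
  · refine qcl_count (qclF a b c d e f g h k l m) (fun x _ => x) (4 * κ) K2 (by positivity) hK2 N hN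
      (row N hN) ?_ ?_
    · intro z
      refine le_trans (le_of_eq ?_) (row N hN z)
      congr 2
      ext n
      constructor
      · rintro ⟨h1, h2, x, y, rfl, h⟩; exact ⟨h1, h2, y, h⟩
      · rintro ⟨h1, h2, y, h⟩; exact ⟨h1, h2, z, y, rfl, h⟩
    · intro x y _ hle
      left
      rcases hgr x y hle with h | ⟨⟨h, _⟩, _⟩
      · exact h
      · exfalso
        have : δ = 0 := by exact_mod_cast h
        omega
  · refine qcl_count (qclF a b c d e f g h k l m) (fun x y => b * x + 2 * c * y) (4 * κ) K2
      (by positivity) hK2 N hN (row N hN) ?_ ?_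
    · intro z
      by_cases hex : ∃ x0 y0 : ℤ, b * x0 + 2 * c * y0 = z
      · obtain ⟨x0, y0, h0⟩ := hex
        have master2 : ∀ x y : ℤ, b * x + 2 * c * y = z →
            (κ : ℤ) * qclF a b c d e f g h k l m x y =
            (c * z ^ 2 + e' * z + q2) * x ^ 2 + (f * z ^ 2 + h' * z + l') * x
              + (k * z ^ 2 + m' * z) := by
          intro x y hz
          rw [master, hz, hd0, hq0]; ring
        have hquad := qcl_quad ((c * z ^ 2 + e' * z + q2) * (4 * c ^ 2))
          (2 * (c * z ^ 2 + e' * z + q2) * x0 * (2 * c) + (f * z ^ 2 + h' * z + l') * (2 * c))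
          ((c * z ^ 2 + e' * z + q2) * x0 ^ 2 + (f * z ^ 2 + h' * z + l') * x0
              + (k * z ^ 2 + m' * z)) (κ * M) (by
            intro t
            have e1 := master2 (x0 + 2 * c * t) (y0 - b * t) (by rw [← h0]; ring)
            have e2 := mul_le_mul_of_nonneg_left (hM (x0 + 2 * c * t) (y0 - b * t))
              (show (0:ℤ) ≤ κ by positivity)
            rw [e1] at e2
            linarith)
        have hq' : 0 < (c * z ^ 2 + e' * z + q2) ∨
            ((c * z ^ 2 + e' * z + q2) = 0 ∧ (f * z ^ 2 + h' * z + l') = 0) := by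
          rcases hquad with h1 | ⟨h1, h2⟩
          · left; exact pos_of_mul_pos_left h1 (by positivity)
          · right
            have h3 : (c * z ^ 2 + e' * z + q2) = 0 := by
              rcases mul_eq_zero.1 h1 with h | h
              · exact h
              · exfalso; have : 0 < 4 * c ^ 2 := by positivity
                omega
            refine ⟨h3, ?_⟩
            rw [h3] at h2
            have h4 : (f * z ^ 2 + h' * z + l') * (2 * c) = 0 := by linarith
            rcases mul_eq_zero.1 h4 with h | h
            · exact h
            · omega
        apply qcl_row _ _ (k * z ^ 2 + m' * z) κ N hκ1 hN hq'
        rintro n ⟨h1, h2, x, y, hz, rfl⟩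
        exact ⟨h1, h2, x, (master2 x y hz).symm⟩
      · have : {n : ℤ | (N : ℤ) ≤ n ∧ n ≤ 2 * N ∧ ∃ x y, b * x + 2 * c * y = z ∧
            qclF a b c d e f g h k l m x y = n} = ∅ := by
          ext n
          simp only [Set.mem_ofPred_eq, Set.mem_empty_iff_false, iff_false]
          rintro ⟨_, _, x, y, hz, _⟩
          exact hex ⟨x, y, hz⟩
        rw [this]
        simp only [Set.ncard_empty, Nat.cast_zero]
        positivity
    · intro x y _ hle
      rcases hgr x y hle with h | ⟨_, h⟩
      · exact Or.inl h
      · exact Or.inr h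

open MvPolynomial in
lemma qcl_hom2 (G : MvPolynomial (Fin 2) ℤ) (hG : G.IsHomogeneous 2) :
    ∃ a b c : ℤ, G = C a * X 0 ^ 2 + C b * (X 0 * X 1) + C c * X 1 ^ 2 := by
  classical
  let s := fun i j : ℕ => (Finsupp.single (0 : Fin 2) i + Finsupp.single (1 : Fin 2) j)
  have hinj : ∀ i j i' j', s i j = s i' j' → i = i' ∧ j = j' := by
    intro i j i' j' h
    have h0 := DFunLike.congr_fun h 0
    have h1 := DFunLike.congr_fun h 1
    simp [s] at h0 h1
    exact ⟨h0, h1⟩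
  have hsub : G.support ⊆ {s 2 0, s 1 1, s 0 2} := by
    intro n hn
    have h1 : n.degree = 2 := by
      have := hG (mem_support_iff.1 hn)
      rw [Finsupp.degree_eq_weight_one]
      exact this
    have h2 : n = s (n 0) (n 1) := by ext i; fin_cases i <;> simp [s]
    have h3 : n 0 + n 1 = 2 := by
      rw [Finsupp.degree_eq_sum] at h1; simpa using h1
    rw [h2]
    generalize n 0 = i at *
    generalize n 1 = j at *
    have : i ≤ 2 := by omega
    interval_cases i
    · obtain rfl : j = 2 := by omega
      simp
    · obtain rfl : j = 1 := by omega
      simp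
    · obtain rfl : j = 0 := by omega
      simp
  refine ⟨coeff (s 2 0) G, coeff (s 1 1) G, coeff (s 0 2) G, ?_⟩
  conv_lhs => rw [G.as_sum]
  rw [Finset.sum_subset hsub (by
    intro n _ hn
    rw [notMem_support_iff.1 hn]; simp)]
  rw [Finset.sum_insert, Finset.sum_insert, Finset.sum_singleton]
  · have hm : ∀ i j r, monomial (s i j) r = (C r * (X 0 ^ i * X 1 ^ j) : MvPolynomial (Fin 2) ℤ) := by
      intro i j r
      rw [X_pow_eq_monomial, X_pow_eq_monomial, monomial_mul, C_mul_monomial]; simp [s]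
    rw [hm, hm, hm]; ring
  · simp only [Finset.mem_singleton]
    intro h; have := hinj _ _ _ _ h; omega
  · simp only [Finset.mem_singleton, Finset.mem_insert]
    rintro (h | h) <;> (have := hinj _ _ _ _ h; omega)

open MvPolynomial in
lemma qcl_hom1 (G : MvPolynomial (Fin 2) ℤ) (hG : G.IsHomogeneous 1) :
    ∃ a b : ℤ, G = C a * X 0 + C b * X 1 := by
  classical
  let s := fun i j : ℕ => (Finsupp.single (0 : Fin 2) i + Finsupp.single (1 : Fin 2) j)
  have hinj : ∀ i j i' j', s i j = s i' j' → i = i' ∧ j = j' := by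
    intro i j i' j' h
    have h0 := DFunLike.congr_fun h 0
    have h1 := DFunLike.congr_fun h 1
    simp [s] at h0 h1
    exact ⟨h0, h1⟩
  have hsub : G.support ⊆ {s 1 0, s 0 1} := by
    intro n hn
    have h1 : n.degree = 1 := by
      have := hG (mem_support_iff.1 hn)
      rw [Finsupp.degree_eq_weight_one]
      exact this
    have h2 : n = s (n 0) (n 1) := by ext i; fin_cases i <;> simp [s]
    have h3 : n 0 + n 1 = 1 := by
      rw [Finsupp.degree_eq_sum] at h1; simpa using h1
    rw [h2]
    generalize n 0 = i at *
    generalize n 1 = j at *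
    have : i ≤ 1 := by omega
    interval_cases i
    · obtain rfl : j = 1 := by omega
      simp
    · obtain rfl : j = 0 := by omega
      simp
  refine ⟨coeff (s 1 0) G, coeff (s 0 1) G, ?_⟩
  conv_lhs => rw [G.as_sum]
  rw [Finset.sum_subset hsub (by
    intro n _ hn
    rw [notMem_support_iff.1 hn]; simp)]
  rw [Finset.sum_insert, Finset.sum_singleton]
  · have hm : ∀ i j r, monomial (s i j) r = (C r * (X 0 ^ i * X 1 ^ j) : MvPolynomial (Fin 2) ℤ) := by
      intro i j r
      rw [X_pow_eq_monomial, X_pow_eq_monomial, monomial_mul, C_mul_monomial]; simp [s]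
    rw [hm, hm]; ring
  · simp only [Finset.mem_singleton]
    intro h; have := hinj _ _ _ _ h; omega

/-- **Proposition 4.1.** Let
`F = H² G₄ + H G₃ + F₂ + F₁` where `H` is a primitive integral linear form, `G₄`, `G₃`
are integral quadratic forms with `H ∤ G₄, G₃`, there is no primitive integral linear
form `L ∤ H` with `L² ∣ G₃`, the degree-4 part `H²G₄` is positive semi-definite, and
`F₂`, `F₁` are arbitrary integral forms of degrees 2 and 1.  Then either
`#ℛ_F([N,2N]) ≪ N^{1-λ}` for some `λ > 0`, or `inf_{(x,y) ∈ ℤ²} F(x,y) = -∞`. -/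
theorem quad_composed_linear_r_one
    (H G4 G3 F2 F1 F : MvPolynomial (Fin 2) ℤ)
    (hH : H.IsHomogeneous 1) (hHprim : IsPrimitiveInt H)
    (hG4 : G4.IsHomogeneous 2) (hG3 : G3.IsHomogeneous 2)
    (hHG4 : ¬ H ∣ G4) (hHG3 : ¬ H ∣ G3)
    (hnoL : ¬ ∃ L : MvPolynomial (Fin 2) ℤ,
      L.IsHomogeneous 1 ∧ IsPrimitiveInt L ∧ ¬ L ∣ H ∧ L * L ∣ G3)
    (hpsd : PosSemidef2 (H * H * G4))
    (hF2 : F2.IsHomogeneous 2) (hF1 : F1.IsHomogeneous 1)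
    (hF : F = H * H * G4 + H * G3 + F2 + F1) :
    (∃ lam c : ℝ, 0 < lam ∧ 0 < c ∧ ∀ᶠ N : ℕ in Filter.atTop,
      ({m : ℤ | (N : ℤ) ≤ m ∧ m ≤ 2 * N ∧
          ∃ x y : ℤ, MvPolynomial.eval ![x, y] F = m}.ncard : ℝ)
        ≤ c * (N : ℝ) ^ (1 - lam)) ∨
    (∀ M : ℤ, ∃ x y : ℤ, MvPolynomial.eval ![x, y] F < -M) := by
  classical
  obtain ⟨h0, h1, rfl⟩ := qcl_hom1 H hH
  obtain ⟨a0, b0, c0, rfl⟩ := qcl_hom2 G4 hG4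
  obtain ⟨d0, e0, f0, rfl⟩ := qcl_hom2 G3 hG3
  obtain ⟨g0, i0, k0, rfl⟩ := qcl_hom2 F2 hF2
  obtain ⟨l0, m0, rfl⟩ := qcl_hom1 F1 hF1
  -- the linear form is primitive, so its coefficients are coprime
  have hcop : IsCoprime h0 h1 := by
    rw [Int.isCoprime_iff_gcd_eq_one]
    have hd := hHprim (Int.gcd h0 h1) (by
      rw [← MvPolynomial.C_dvd_iff_dvd_coeff]
      exact dvd_add (Dvd.dvd.mul_right (map_dvd _ (Int.gcd_dvd_left ..)) _)
        (Dvd.dvd.mul_right (map_dvd _ (Int.gcd_dvd_right ..)) _))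
    simpa [Int.isUnit_iff_natAbs_eq] using hd
  obtain ⟨u, v, huv⟩ := hcop
  -- transformed coefficients
  obtain ⟨a, ha⟩ : ∃ r : ℤ, r = a0 * u ^ 2 + b0 * u * v + c0 * v ^ 2 := ⟨_, rfl⟩
  obtain ⟨b, hb⟩ : ∃ r : ℤ, r = -2 * a0 * u * h1 + b0 * (u * h0 - h1 * v) + 2 * c0 * v * h0 :=
    ⟨_, rfl⟩
  obtain ⟨c, hc⟩ : ∃ r : ℤ, r = a0 * h1 ^ 2 - b0 * h1 * h0 + c0 * h0 ^ 2 := ⟨_, rfl⟩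
  have hc0 : c ≠ 0 := by
    intro hc0
    apply hHG4
    refine ⟨MvPolynomial.C a * (MvPolynomial.C h0 * MvPolynomial.X 0
        + MvPolynomial.C h1 * MvPolynomial.X 1)
      + MvPolynomial.C b * (MvPolynomial.C u * MvPolynomial.X 1
        - MvPolynomial.C v * MvPolynomial.X 0), ?_⟩
    have e1 := congrArg (MvPolynomial.C (σ := Fin 2)) huv
    have e2 := congrArg (MvPolynomial.C (σ := Fin 2)) (hc.symm.trans hc0)
    rw [ha, hb]
    simp only [map_add, map_mul, map_sub, map_pow, map_neg, map_one, map_zero,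
      map_ofNat] at e1 e2 ⊢
    generalize (MvPolynomial.C a0 : MvPolynomial (Fin 2) ℤ) = A at *
    generalize (MvPolynomial.C b0 : MvPolynomial (Fin 2) ℤ) = B at *
    generalize (MvPolynomial.C c0 : MvPolynomial (Fin 2) ℤ) = D at *
    generalize (MvPolynomial.C h0 : MvPolynomial (Fin 2) ℤ) = P at *
    generalize (MvPolynomial.C h1 : MvPolynomial (Fin 2) ℤ) = Q at *
    generalize (MvPolynomial.C u : MvPolynomial (Fin 2) ℤ) = U at *
    generalize (MvPolynomial.C v : MvPolynomial (Fin 2) ℤ) = W at *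
    generalize (MvPolynomial.X 0 : MvPolynomial (Fin 2) ℤ) = x at *
    generalize (MvPolynomial.X 1 : MvPolynomial (Fin 2) ℤ) = y at *
    have hx : x = U * (P * x + Q * y) - Q * (U * y - W * x) := by linear_combination (-x) * e1
    have hy : y = W * (P * x + Q * y) + P * (U * y - W * x) := by linear_combination (-y) * e1
    generalize hS : P * x + Q * y = S at *
    generalize hR : U * y - W * x = R at *
    rw [hx, hy]
    linear_combination R ^ 2 * e2
  -- positivity
  have hpos : ∀ t : ℝ, 0 ≤ (c : ℝ) * (t * t) + b * t + a := by
    intro t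
    have h := hpsd (u - h1 * t) (v + h0 * t)
    simp only [evalReal, map_add, map_mul, map_pow, MvPolynomial.aeval_X, MvPolynomial.aeval_C,
      Matrix.cons_val_zero, Matrix.cons_val_one, algebraMap_int_eq, eq_intCast, map_intCast] at h
    have e1 : (u : ℝ) * h0 + v * h1 = 1 := by exact_mod_cast huv
    have e2 : (h0 : ℝ) * (u - h1 * t) + h1 * (v + h0 * t) = 1 := by linear_combination e1
    rw [e2] at h
    rw [ha, hb, hc]
    push_cast
    linarith
  have hdisc : b ^ 2 ≤ 4 * a * c := by
    have := discrim_le_zero hpos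
    unfold discrim at this
    have h2 : (b : ℝ) ^ 2 ≤ 4 * a * c := by linarith
    exact_mod_cast h2
  have hcpos : 0 < c := by
    rcases lt_or_gt_of_ne hc0 with h | h
    · exfalso
      have hneg := qcl_quad c b a 0 (by
        intro t
        have := hpos t
        have h2 : (0:ℝ) ≤ ((c * t ^ 2 + b * t + a : ℤ) : ℝ) := by push_cast; linarith
        have h3 : (0:ℤ) ≤ c * t ^ 2 + b * t + a := by exact_mod_cast h2
        linarith)
      omega
    · exact h
  -- the function in new coordinates
  obtain ⟨G, hG⟩ : ∃ G : ℤ → ℤ → ℤ, G = qclF a b c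
      (d0 * u ^ 2 + e0 * u * v + f0 * v ^ 2)
      (-2 * d0 * u * h1 + e0 * (u * h0 - h1 * v) + 2 * f0 * v * h0)
      (d0 * h1 ^ 2 - e0 * h1 * h0 + f0 * h0 ^ 2)
      (g0 * u ^ 2 + i0 * u * v + k0 * v ^ 2)
      (-2 * g0 * u * h1 + i0 * (u * h0 - h1 * v) + 2 * k0 * v * h0)
      (g0 * h1 ^ 2 - i0 * h1 * h0 + k0 * h0 ^ 2)
      (l0 * u + m0 * v) (-l0 * h1 + m0 * h0) := ⟨_, rfl⟩
  have hFG : ∀ s t : ℤ, MvPolynomial.eval ![u * s - h1 * t, v * s + h0 * t] F = G s t := by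
    intro s t
    rw [hF, hG, ha, hb, hc]
    simp only [qclF, map_add, map_mul, map_pow, MvPolynomial.eval_X, MvPolynomial.eval_C,
      Matrix.cons_val_zero, Matrix.cons_val_one]
    have e2 : h0 * (u * s - h1 * t) + h1 * (v * s + h0 * t) = s := by linear_combination s * huv
    rw [e2]
    ring
  have hGF : ∀ x y : ℤ, MvPolynomial.eval ![x, y] F = G (h0 * x + h1 * y) (u * y - v * x) := by
    intro x y
    rw [← hFG]
    have e1 : u * (h0 * x + h1 * y) - h1 * (u * y - v * x) = x := by linear_combination x * huv
    have e2 : v * (h0 * x + h1 * y) + h0 * (u * y - v * x) = y := by linear_combination y * huv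
    rw [e1, e2]
  by_cases hbd : ∀ M : ℤ, ∃ x y : ℤ, MvPolynomial.eval ![x, y] F < -M
  · exact Or.inr hbd
  left
  push Not at hbd
  obtain ⟨M, hM⟩ := hbd
  have hM' : ∀ s t, -M ≤ G s t := fun s t => by rw [← hFG]; exact hM _ _
  obtain ⟨C, hC, hcount⟩ := qcl_core a b c _ _ _ _ _ _ _ _ hcpos hdisc M (by rw [hG] at hM'; exact hM')
  refine ⟨1 / 4, C, by norm_num, hC, ?_⟩
  filter_upwards [Filter.eventually_ge_atTop 1] with N hN
  have := hcount N hN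
  rw [← hG] at this
  refine le_trans (le_of_eq ?_) this
  congr 2
  ext n
  simp only [Set.mem_ofPred_eq]
  constructor
  · rintro ⟨p1, p2, x, y, h⟩
    exact ⟨p1, p2, _, _, (hGF x y).symm.trans h⟩
  · rintro ⟨p1, p2, s, t, h⟩
    exact ⟨p1, p2, _, _, (hFG s t).trans h⟩
end

section
/- Let F(x,y) = a_4 H(x,y)⁴ + H(x,y)² G_3(x,y) + F_2(x,y) + F_1(x,y) ∈ ℤ[x,y], where H is a primitive integral linear form, a_4 is a positive integer, G_3 is an integral linear form not divisible by H (i.e., not proportional to H), and F_2, F_1 are arbitrary integral forms of degrees 2 and 1 (possibly zero). Then either #ℛ_F([N,2N]) ≪ N/√(log N), or the infimum of F(x,y) over (x,y) ∈ ℤ² is −∞. -/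
section Helpers
open scoped NumberTheorySymbols
open Filter Topology

/-- The Jacobi character `n ↦ J(-A | n)` as a Dirichlet character modulo `4A`. -/
noncomputable def jacChar (A : ℕ) [NeZero (4 * A)] : DirichletCharacter ℂ (4 * A) where
  toFun a := by classical exact if IsUnit a then ((J(-(A : ℤ) | a.val) : ℤ) : ℂ) else 0
  map_one' := by
    have hA : A ≠ 0 := by
      have := NeZero.ne (4 * A)
      omega
    have h1 : (1 : ZMod (4 * A)).val = 1 := by
      rw [ZMod.val_one_eq_one_mod]
      exact Nat.mod_eq_of_lt (by omega)
    simp [h1, jacobiSym.one_right]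
  map_mul' := by
    intro a b
    by_cases ha : IsUnit a
    · by_cases hb : IsUnit b
      · have hab : IsUnit (a * b) := ha.mul hb
        simp only [ha, hb, hab, if_true]
        have hodd : ∀ c : ZMod (4 * A), IsUnit c → Odd c.val := by
          intro c hc
          have := ZMod.val_coe_unit_coprime hc.unit
          rw [IsUnit.unit_spec] at this
          rw [← Nat.coprime_two_right]
          exact Nat.Coprime.coprime_mul_right_right (k := 2 * A) (by convert this using 1; ring)
        have h1 := hodd a ha
        have h2 := hodd b hb
        have h3 : J(-(A : ℤ) | (a * b).val) = J(-(A : ℤ) | a.val) * J(-(A : ℤ) | b.val) := by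
          have hz1 : NeZero a.val := ⟨by rintro h; rw [h] at h1; exact absurd h1 (by decide)⟩
          have hz2 : NeZero b.val := ⟨by rintro h; rw [h] at h2; exact absurd h2 (by decide)⟩
          rw [ZMod.val_mul, ← jacobiSym.mul_right (-(A : ℤ)) a.val b.val,
            jacobiSym.mod_right _ (h1.mul h2)]
          simp
        rw [h3]; push_cast; rfl
      · have hab : ¬ IsUnit (a * b) := fun h => hb (isUnit_of_mul_isUnit_right h)
        simp [hb, hab]
    · have hab : ¬ IsUnit (a * b) := fun h => ha (isUnit_of_mul_isUnit_left h)
      simp [ha, hab]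
  map_nonunit' := by
    intro a ha
    simp [ha]

lemma jacChar_apply (A : ℕ) [NeZero (4 * A)] (a : ZMod (4 * A)) (ha : IsUnit a) :
    jacChar A a = ((J(-(A : ℤ) | a.val) : ℤ) : ℂ) := by
  change (if IsUnit a then ((J(-(A : ℤ) | a.val) : ℤ) : ℂ) else 0) = _
  rw [if_pos ha]

lemma jacChar_nat (A : ℕ) [NeZero (4 * A)] (n : ℕ) (h : n.Coprime (4 * A)) :
    jacChar A (n : ZMod (4 * A)) = ((J(-(A : ℤ) | n) : ℤ) : ℂ) := by
  have hu : IsUnit (n : ZMod (4 * A)) := (ZMod.isUnit_iff_coprime n (4 * A)).2 h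
  have ho : Odd n := by
    rw [← Nat.coprime_two_right]
    exact Nat.Coprime.coprime_mul_right_right (k := 2 * A) (by convert h using 1; ring)
  rw [jacChar_apply A _ hu, ZMod.val_natCast, jacobiSym.mod_right _ ho]
  simp

lemma jacChar_ne_one (A : ℕ) [NeZero (4 * A)] : jacChar A ≠ 1 := by
  have hA : A ≠ 0 := by
    have := NeZero.ne (4 * A)
    omega
  intro h
  have hc : (4 * A - 1).Coprime (4 * A) := by
    have : (4 * A - 1).Coprime (4 * A - 1 + 1) := by simp
    rwa [Nat.sub_add_cancel (by omega)] at this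
  have h1 := jacChar_nat A (4 * A - 1) hc
  have hu : IsUnit ((4 * A - 1 : ℕ) : ZMod (4 * A)) := (ZMod.isUnit_iff_coprime _ (4 * A)).2 hc
  rw [h, MulChar.one_apply hu] at h1
  have h2 : J(-(A : ℤ) | 4 * A - 1) = 1 := by exact_mod_cast h1.symm
  have ho : Odd (4 * A - 1) := ⟨2 * A - 1, by omega⟩
  have h4 : J(4 | 4 * A - 1) = 1 := by
    have : J((2 : ℤ) ^ 2 | 4 * A - 1) = 1 := by
      apply jacobiSym.sq_one'
      rw [Int.gcd]
      simpa using ho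
    norm_num at this
    exact this
  have h3 : J(-(A : ℤ) * 4 | 4 * A - 1) = 1 := by
    rw [jacobiSym.mul_left, h2, h4]; norm_num
  have h5 : J(-(A : ℤ) * 4 | 4 * A - 1) = J(-1 | 4 * A - 1) := by
    rw [jacobiSym.mod_left, jacobiSym.mod_left (-1)]
    congr 1
    apply Int.ModEq.eq
    apply Int.ModEq.symm
    rw [Int.modEq_iff_dvd]
    refine ⟨-1, ?_⟩
    push_cast [Nat.cast_sub (show 1 ≤ 4 * A by omega)]
    ring
  rw [h5, jacobiSym.at_neg_one ho, ZMod.χ₄_nat_three_mod_four (by omega)] at h3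
  norm_num at h3

/-- Bad primes: inert primes for `-A`. -/
def BadP (A p : ℕ) : Prop := p.Prime ∧ ¬ p ∣ 4 * A ∧ J(-(A : ℤ) | p) = -1

open Classical in
/-- Indicator of integers free of bad primes. -/
noncomputable def gInd (A : ℕ) : ℕ →*₀ ℝ where
  toFun n := if n ≠ 0 ∧ ∀ p, p ∣ n → ¬ BadP A p then 1 else 0
  map_zero' := by simp
  map_one' := by
    have : ∀ p, p ∣ 1 → ¬ BadP A p := by
      intro p hp hb
      rw [Nat.dvd_one] at hp
      exact hb.1.ne_one hp
    rw [if_pos ⟨one_ne_zero, this⟩]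
  map_mul' := by
    intro m n
    have : (m * n ≠ 0 ∧ ∀ p, p ∣ m * n → ¬ BadP A p) ↔
        (m ≠ 0 ∧ ∀ p, p ∣ m → ¬ BadP A p) ∧ (n ≠ 0 ∧ ∀ p, p ∣ n → ¬ BadP A p) := by
      constructor
      · rintro ⟨h0, h⟩
        rw [mul_ne_zero_iff] at h0
        exact ⟨⟨h0.1, fun p hp => h p (hp.mul_right n)⟩, ⟨h0.2, fun p hp => h p (hp.mul_left m)⟩⟩
      · rintro ⟨⟨h1, h2⟩, h3, h4⟩
        refine ⟨mul_ne_zero h1 h3, fun p hp hb => ?_⟩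
        rcases (hb.1.dvd_mul).1 hp with h | h
        · exact h2 p h hb
        · exact h4 p h hb
    simp only [this]
    by_cases h1 : (m ≠ 0 ∧ ∀ p, p ∣ m → ¬ BadP A p) <;>
    by_cases h2 : (n ≠ 0 ∧ ∀ p, p ∣ n → ¬ BadP A p) <;> split_ifs <;> first | (norm_num; done) | tauto

open Classical in
lemma gInd_apply (A n : ℕ) :
    gInd A n = if n ≠ 0 ∧ ∀ p, p ∣ n → ¬ BadP A p then 1 else 0 := rfl

lemma gInd_nonneg (A n : ℕ) : 0 ≤ gInd A n := by
  rw [gInd_apply]; split_ifs <;> norm_num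

lemma gInd_le_one (A n : ℕ) : gInd A n ≤ 1 := by
  rw [gInd_apply]; split_ifs <;> norm_num

lemma gInd_bad (A p : ℕ) (h : BadP A p) : gInd A p = 0 := by
  rw [gInd_apply, if_neg]
  rintro ⟨_, h2⟩
  exact h2 p dvd_rfl h

/-- `n ↦ n^(-s)` as a hom. -/
noncomputable def powHom (s : ℝ) (hs : s ≠ 0) : ℕ →*₀ ℝ where
  toFun n := (n : ℝ) ^ (-s)
  map_zero' := by simp [Real.zero_rpow (neg_ne_zero.2 hs)]
  map_one' := by simp
  map_mul' m n := by
    push_cast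
    exact Real.mul_rpow (Nat.cast_nonneg m) (Nat.cast_nonneg n)

lemma local_ineq (A p : ℕ) [NeZero (4 * A)] (hp : p.Prime) (s : ℝ) (hs : 1 < s) :
    ((1 - gInd A p * (p : ℝ) ^ (-s))⁻¹) ^ 2 ≤
      (1 - (p : ℝ) ^ (-s))⁻¹ * ‖(1 - jacChar A p * (p : ℂ) ^ (-(s : ℂ)))⁻¹‖ *
        (if p ∣ 4 * A then 2 else 1) := by
  have hp2 : (2 : ℝ) ≤ p := by exact_mod_cast hp.two_le
  have hcast : (p : ℂ) ^ (-(s : ℂ)) = (((p : ℝ) ^ (-s) : ℝ) : ℂ) := by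
    rw [Complex.ofReal_cpow (by positivity)]
    push_cast; rfl
  rw [hcast]
  set t := (p : ℝ) ^ (-s) with ht
  have ht0 : 0 < t := by positivity
  have ht1 : t ≤ 1 / 2 := by
    calc t ≤ (p : ℝ) ^ (-1 : ℝ) := Real.rpow_le_rpow_of_exponent_le (by linarith) (by linarith)
      _ = (p : ℝ)⁻¹ := Real.rpow_neg_one _
      _ ≤ 1 / 2 := by rw [inv_le_comm₀ (by linarith) (by norm_num)]; norm_num; exact hp.two_le
  have hpos : 0 < 1 - t := by linarith
  have hg1 : ∀ g : ℝ, 0 ≤ g → g ≤ 1 → ((1 - g * t)⁻¹) ^ 2 ≤ ((1 - t)⁻¹) ^ 2 := by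
    intro g hg0 hg
    have : 1 - t ≤ 1 - g * t := by nlinarith
    have h0 : 0 ≤ (1 - g * t)⁻¹ := inv_nonneg.2 (by linarith)
    gcongr
  by_cases hd : p ∣ 4 * A
  · have hnu : ¬ IsUnit (p : ZMod (4 * A)) := by
      rw [ZMod.isUnit_iff_coprime, hp.coprime_iff_not_dvd]
      exact fun h => h hd
    rw [MulChar.map_nonunit _ hnu, if_pos hd]
    refine (hg1 _ (gInd_nonneg A p) (gInd_le_one A p)).trans ?_
    simp only [zero_mul, sub_zero, inv_one, norm_one, mul_one]
    rw [pow_two]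
    gcongr
    rw [inv_le_comm₀ hpos (by norm_num)]
    linarith
  · have hc : p.Coprime (4 * A) := (hp.coprime_iff_not_dvd).2 hd
    rw [jacChar_nat A p hc, if_neg hd, mul_one]
    have hodd : Int.gcd (-(A : ℤ)) p = 1 := by
      rw [Int.gcd]
      simp only [Int.natAbs_neg, Int.natAbs_natCast]
      exact (hc.symm).coprime_mul_left
    rcases jacobiSym.eq_one_or_neg_one hodd with h | h
    · rw [h]
      refine (hg1 _ (gInd_nonneg A p) (gInd_le_one A p)).trans ?_
      have : (1 - ((1 : ℤ) : ℂ) * (t : ℂ))⁻¹ = (((1 - t)⁻¹ : ℝ) : ℂ) := by push_cast; ring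
      rw [this, Complex.norm_real, Real.norm_of_nonneg (by positivity), pow_two]
    · rw [h, gInd_bad A p ⟨hp, hd, h⟩]
      have : (1 - ((-1 : ℤ) : ℂ) * (t : ℂ))⁻¹ = (((1 + t)⁻¹ : ℝ) : ℂ) := by push_cast; ring
      rw [this, Complex.norm_real, Real.norm_of_nonneg (by positivity), ← mul_inv]
      simp only [zero_mul, sub_zero, inv_one, one_pow]
      rw [one_le_inv₀ (by positivity)]
      nlinarith

lemma summable_powHom (s : ℝ) (hs : 1 < s) : Summable (fun n : ℕ => (n : ℝ) ^ (-s)) :=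
  Real.summable_nat_rpow.2 (by linarith)

lemma summable_gpow (A : ℕ) (s : ℝ) (hs : 1 < s) :
    Summable (fun n : ℕ => gInd A n * (n : ℝ) ^ (-s)) :=
  (summable_powHom s hs).of_nonneg_of_le
    (fun n => mul_nonneg (gInd_nonneg A n) (by positivity))
    (fun n => mul_le_of_le_one_left (by positivity) (gInd_le_one A n))

lemma global_ineq (A : ℕ) [NeZero (4 * A)] (s : ℝ) (hs : 1 < s) :
    (∑' n : ℕ, gInd A n * (n : ℝ) ^ (-s)) ^ 2 ≤
      (∑' n : ℕ, (n : ℝ) ^ (-s)) * ‖DirichletCharacter.LFunction (jacChar A) s‖ * 2 ^ (4 * A) := by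
  have hs0 : s ≠ 0 := by linarith
  have hZ := EulerProduct.eulerProduct_completely_multiplicative (f := powHom s hs0)
    ((summable_powHom s hs).congr (fun n => by
      simp only [powHom]; exact (Real.norm_of_nonneg (by positivity)).symm))
  have hG := EulerProduct.eulerProduct_completely_multiplicative (f := gInd A * powHom s hs0)
    ((summable_gpow A s hs).congr (fun n => by
      simp only [powHom]
      exact (Real.norm_of_nonneg (mul_nonneg (gInd_nonneg A n) (by positivity))).symm))
  have hL := (DirichletCharacter.LSeries_eulerProduct (jacChar A) (s := (s : ℂ)) (by simpa)).norm
  rw [← DirichletCharacter.LFunction_eq_LSeries (jacChar A) (by simpa)] at hL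
  refine le_of_tendsto_of_tendsto' (hG.pow 2) ((hZ.mul hL).mul_const _) ?_
  intro k
  rw [norm_prod, ← Finset.prod_mul_distrib, ← Finset.prod_pow]
  have hstep : ∏ p ∈ Nat.primesBelow k, (if p ∣ 4 * A then (2 : ℝ) else 1) ≤ 2 ^ (4 * A) := by
    rw [← Finset.prod_filter, Finset.prod_const]
    apply pow_le_pow_right₀ (by norm_num)
    have : (Nat.primesBelow k).filter (fun p => p ∣ 4 * A) ⊆ Nat.divisors (4 * A) := by
      intro p hp
      rw [Finset.mem_filter] at hp
      exact Nat.mem_divisors.2 ⟨hp.2, NeZero.ne _⟩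
    exact (Finset.card_le_card this).trans (Nat.card_divisors_le_self _)
  refine (Finset.prod_le_prod (fun p _ => by positivity) (fun p hp =>
    local_ineq A p (Nat.prime_of_mem_primesBelow hp) s hs)).trans ?_
  rw [Finset.prod_mul_distrib]
  refine mul_le_mul_of_nonneg_left hstep (Finset.prod_nonneg fun p hp => ?_)
  refine mul_nonneg ?_ (norm_nonneg _)
  have hp2 : (1 : ℝ) ≤ p := by exact_mod_cast (Nat.prime_of_mem_primesBelow hp).one_lt.le
  have : (p : ℝ) ^ (-s) ≤ 1 := Real.rpow_le_one_of_one_le_of_nonpos hp2 (by linarith)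
  rw [inv_nonneg]
  exact sub_nonneg.2 this

lemma dir_bound (A : ℕ) [NeZero (4 * A)] : ∃ K : ℝ, 0 < K ∧ ∀ᶠ s : ℝ in 𝓝[>] 1,
    (s - 1) * (∑' n : ℕ, gInd A n * (n : ℝ) ^ (-s)) ^ 2 ≤ K := by
  have hc : Continuous (fun s : ℝ => ‖DirichletCharacter.LFunction (jacChar A) s‖) :=
    ((DirichletCharacter.differentiable_LFunction (jacChar_ne_one A)).continuous.comp
      Complex.continuous_ofReal).norm
  have h1 : ∀ᶠ s : ℝ in 𝓝[>] 1, ‖DirichletCharacter.LFunction (jacChar A) s‖ <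
      ‖DirichletCharacter.LFunction (jacChar A) (1 : ℝ)‖ + 1 :=
    ((hc.tendsto 1).mono_left nhdsWithin_le_nhds).eventually (gt_mem_nhds (lt_add_one _))
  set Q := ‖DirichletCharacter.LFunction (jacChar A) (1 : ℝ)‖ + 1 with hQ
  have hQ0 : 0 < Q := by positivity
  have h2 := tendsto_sub_mul_tsum_nat_rpow.eventually (gt_mem_nhds (show (1 : ℝ) < 2 by norm_num))
  refine ⟨2 * Q * 2 ^ (4 * A), by positivity, ?_⟩
  filter_upwards [h1, h2, self_mem_nhdsWithin] with s hs1 hs2 hs3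
  have hs : 1 < s := hs3
  have h := global_ineq A s hs
  have he : (∑' n : ℕ, 1 / (n : ℝ) ^ s) = ∑' n : ℕ, (n : ℝ) ^ (-s) := by
    congr 1; ext n
    rw [Real.rpow_neg (Nat.cast_nonneg n), one_div]
  rw [he] at hs2
  set Z := ∑' n : ℕ, (n : ℝ) ^ (-s)
  have hZ : 0 ≤ Z := tsum_nonneg fun n => by positivity
  calc _ ≤ (s - 1) * (Z * ‖DirichletCharacter.LFunction (jacChar A) s‖ * 2 ^ (4 * A)) :=
        mul_le_mul_of_nonneg_left h (by linarith)
    _ = ((s - 1) * Z) * ‖DirichletCharacter.LFunction (jacChar A) s‖ * 2 ^ (4 * A) := by ring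
    _ ≤ _ := by gcongr

/-- Counting function of integers free of bad primes. -/
noncomputable def gSum (A X : ℕ) : ℝ := ∑ n ∈ Finset.Ioc 0 X, gInd A n

lemma gSum_nonneg (A X : ℕ) : 0 ≤ gSum A X := Finset.sum_nonneg fun n _ => gInd_nonneg A n

lemma gSum_le (A X : ℕ) : gSum A X ≤ X := by
  have := Finset.sum_le_sum (s := Finset.Ioc 0 X) (fun n _ => gInd_le_one A n)
  simpa [gSum] using this

lemma log_sum (A X : ℕ) : ∑ n ∈ Finset.Ioc 0 X, gInd A n * Real.log n ≤
    (Real.log 4 + 4) * X * ∑ m ∈ Finset.Ioc 0 X, gInd A m / m := by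
  let f : ArithmeticFunction ℝ := ⟨fun n => gInd A n, map_zero _⟩
  let h : ArithmeticFunction ℝ :=
    ⟨fun n => gInd A n * ArithmeticFunction.vonMangoldt n, by simp⟩
  have key := ArithmeticFunction.sum_Ioc_mul_eq_sum_sum f h X
  have e1 : ∀ n : ℕ, (f * h) n = gInd A n * Real.log n := by
    intro n
    rw [ArithmeticFunction.mul_apply, ← ArithmeticFunction.vonMangoldt_sum, Finset.mul_sum]
    rw [Nat.sum_divisorsAntidiagonal' (f := fun i j => f i * h j)]
    apply Finset.sum_congr rfl
    intro i hi
    change gInd A (n / i) * (gInd A i * ArithmeticFunction.vonMangoldt i) = _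
    rw [← mul_assoc, ← map_mul, Nat.div_mul_cancel (Nat.dvd_of_mem_divisors hi)]
  simp only [e1] at key
  rw [key, Finset.mul_sum]
  apply Finset.sum_le_sum
  intro n hn
  rw [Finset.mem_Ioc] at hn
  have hn0 : (0 : ℝ) < n := by exact_mod_cast hn.1
  have h1 : ∑ m ∈ Finset.Ioc 0 (X / n), h m ≤ (Real.log 4 + 4) * ((X : ℝ) / n) := by
    calc ∑ m ∈ Finset.Ioc 0 (X / n), h m
        ≤ ∑ m ∈ Finset.Ioc 0 (X / n), ArithmeticFunction.vonMangoldt m := by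
          apply Finset.sum_le_sum
          intro m _
          exact mul_le_of_le_one_left ArithmeticFunction.vonMangoldt_nonneg (gInd_le_one A m)
      _ = Chebyshev.psi ((X : ℝ) / n) := by
          rw [Chebyshev.psi, Nat.floor_div_natCast, Nat.floor_natCast]
      _ ≤ _ := Chebyshev.psi_le_const_mul_self (by positivity)
  calc f n * ∑ m ∈ Finset.Ioc 0 (X / n), h m ≤ gInd A n * ((Real.log 4 + 4) * ((X : ℝ) / n)) :=
        mul_le_mul_of_nonneg_left h1 (gInd_nonneg A n)
    _ = _ := by ring

lemma gSum_log (A X : ℕ) : gSum A X * Real.log X ≤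
    (Real.log 4 + 5) * X * ∑ m ∈ Finset.Ioc 0 X, gInd A m / m := by
  have h1 : gSum A X * Real.log X ≤ ∑ n ∈ Finset.Ioc 0 X, gInd A n * Real.log n +
      X * ∑ m ∈ Finset.Ioc 0 X, gInd A m / m := by
    rw [gSum, Finset.sum_mul, Finset.mul_sum, ← Finset.sum_add_distrib]
    apply Finset.sum_le_sum
    intro n hn
    rw [Finset.mem_Ioc] at hn
    have hn0 : (0 : ℝ) < n := by exact_mod_cast hn.1
    have hX0 : (0 : ℝ) < X := by exact_mod_cast hn.1.trans_le hn.2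
    have h2 : Real.log X - Real.log n ≤ X / n := by
      rw [← Real.log_div hX0.ne' hn0.ne']
      have := Real.log_le_sub_one_of_pos (div_pos hX0 hn0)
      linarith
    have := mul_le_mul_of_nonneg_left h2 (gInd_nonneg A n)
    calc gInd A n * Real.log X = gInd A n * Real.log n + gInd A n * (Real.log X - Real.log n) := by
          ring
      _ ≤ gInd A n * Real.log n + gInd A n * (X / n) := by linarith
      _ = _ := by ring
  have h2 := log_sum A X
  linarith

lemma recip_le (A X : ℕ) (hX : 2 ≤ X) : ∑ m ∈ Finset.Ioc 0 X, gInd A m / m ≤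
    Real.exp 1 * ∑' n : ℕ, gInd A n * (n : ℝ) ^ (-(1 + 1 / Real.log X)) := by
  have hX1 : (1 : ℝ) < X := by exact_mod_cast hX
  have hlog : 0 < Real.log X := Real.log_pos hX1
  have hs : 1 < 1 + 1 / Real.log X := by
    have : 0 < 1 / Real.log X := by positivity
    linarith
  have hsum := summable_gpow A _ hs
  have h1 := hsum.sum_le_tsum (Finset.Ioc 0 X)
    (fun n _ => mul_nonneg (gInd_nonneg A n) (by positivity))
  refine le_trans ?_ (mul_le_mul_of_nonneg_left h1 (Real.exp_pos 1).le)
  rw [Finset.mul_sum]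
  apply Finset.sum_le_sum
  intro n hn
  rw [Finset.mem_Ioc] at hn
  have hn0 : (0 : ℝ) < n := by exact_mod_cast hn.1
  have hnX : (n : ℝ) ≤ X := by exact_mod_cast hn.2
  have h3 : (n : ℝ)⁻¹ ≤ Real.exp 1 * (n : ℝ) ^ (-(1 + 1 / Real.log X)) := by
    rw [Real.rpow_def_of_pos hn0, ← Real.exp_add]
    rw [← Real.exp_log (inv_pos.2 hn0), Real.log_inv]
    apply Real.exp_le_exp.2
    have h4 : Real.log n / Real.log X ≤ 1 := by
      rw [div_le_one hlog]
      exact Real.log_le_log hn0 hnX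
    have h5 : 1 + Real.log n * -(1 + 1 / Real.log X) = 1 - Real.log n - Real.log n / Real.log X := by
      ring
    rw [h5]; linarith
  calc gInd A n / n = gInd A n * (n : ℝ)⁻¹ := by rw [div_eq_mul_inv]
    _ ≤ gInd A n * (Real.exp 1 * (n : ℝ) ^ (-(1 + 1 / Real.log X))) :=
        mul_le_mul_of_nonneg_left h3 (gInd_nonneg A n)
    _ = _ := by ring

lemma gSum_ev (A : ℕ) [NeZero (4 * A)] : ∃ C : ℝ, 0 < C ∧ ∀ᶠ X : ℕ in atTop,
    gSum A X ≤ C * X / Real.sqrt (Real.log X) := by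
  obtain ⟨K, hK, hev⟩ := dir_bound A
  have ht : Tendsto (fun X : ℕ => 1 + 1 / Real.log X) atTop (𝓝[>] 1) := by
    rw [tendsto_nhdsWithin_iff]
    constructor
    · have : Tendsto (fun X : ℕ => 1 / Real.log X) atTop (𝓝 0) := by
        simp only [one_div]
        exact (Real.tendsto_log_atTop.comp tendsto_natCast_atTop_atTop).inv_tendsto_atTop
      simpa using this.const_add 1
    · filter_upwards [eventually_ge_atTop 2] with X hX
      have hX1 : (1 : ℝ) < X := by exact_mod_cast hX
      have := Real.log_pos hX1
      have : 0 < 1 / Real.log X := by positivity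
      simp only [Set.mem_Ioi]; linarith
  have h4 : 0 < Real.log 4 + 5 := by
    have := Real.log_nonneg (show (1 : ℝ) ≤ 4 by norm_num)
    linarith
  refine ⟨(Real.log 4 + 5) * Real.exp 1 * Real.sqrt K, by positivity, ?_⟩
  filter_upwards [ht.eventually hev, eventually_ge_atTop 2] with X hX hX2
  have hX1 : (1 : ℝ) < X := by exact_mod_cast hX2
  have hlog : 0 < Real.log X := Real.log_pos hX1
  set T := ∑' n : ℕ, gInd A n * (n : ℝ) ^ (-(1 + 1 / Real.log X)) with hT
  have hT2 : T ≤ Real.sqrt K * Real.sqrt (Real.log X) := by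
    rw [← Real.sqrt_mul hK.le]
    apply Real.le_sqrt_of_sq_le
    have : (1 + 1 / Real.log X - 1) * T ^ 2 = T ^ 2 / Real.log X := by ring
    rw [this, div_le_iff₀ hlog] at hX
    exact hX
  have h1 := gSum_log A X
  have h2 := recip_le A X hX2
  rw [← hT] at h2
  have hsq : Real.sqrt (Real.log X) * Real.sqrt (Real.log X) = Real.log X :=
    Real.mul_self_sqrt hlog.le
  have hsp : 0 < Real.sqrt (Real.log X) := Real.sqrt_pos.2 hlog
  rw [le_div_iff₀ hsp]
  have h3 : gSum A X * Real.log X ≤ (Real.log 4 + 5) * X *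
      (Real.exp 1 * (Real.sqrt K * Real.sqrt (Real.log X))) := by
    refine h1.trans ?_
    gcongr
    exact h2.trans (by gcongr)
  have h5 : (gSum A X * Real.sqrt (Real.log X)) * Real.sqrt (Real.log X) ≤
      ((Real.log 4 + 5) * Real.exp 1 * Real.sqrt K * X) * Real.sqrt (Real.log X) := by
    calc _ = gSum A X * (Real.sqrt (Real.log X) * Real.sqrt (Real.log X)) := by ring
      _ = gSum A X * Real.log X := by rw [hsq]
      _ ≤ _ := h3
      _ = _ := by ring
  exact le_of_mul_le_mul_right h5 hsp

lemma gSum_all (A : ℕ) [NeZero (4 * A)] : ∃ C : ℝ, 0 < C ∧ ∀ X : ℕ, 1 ≤ X →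
    gSum A X ≤ C * X / Real.sqrt (1 + Real.log X) := by
  obtain ⟨C, hC, hev⟩ := gSum_ev A
  obtain ⟨X0, hX0⟩ := eventually_atTop.1 hev
  set Y : ℕ := max X0 3 with hY
  refine ⟨C * Real.sqrt 2 + Real.sqrt (1 + Real.log Y), by positivity, fun X hX => ?_⟩
  have hX1 : (1 : ℝ) ≤ X := by exact_mod_cast hX
  have hl0 : 0 ≤ Real.log X := Real.log_nonneg hX1
  have hsp : 0 < Real.sqrt (1 + Real.log X) := Real.sqrt_pos.2 (by linarith)
  rw [add_mul, add_div]
  by_cases h : Y ≤ X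
  · have h3 : (3 : ℝ) ≤ X := by exact_mod_cast (le_max_right X0 3).trans h
    have hl1 : 1 ≤ Real.log X := by
      rw [Real.le_log_iff_exp_le (by linarith)]
      have := Real.exp_one_lt_d9
      linarith
    have h1 := hX0 X ((le_max_left X0 3).trans h)
    have h2 : C * X / Real.sqrt (Real.log X) ≤ C * Real.sqrt 2 * X / Real.sqrt (1 + Real.log X) := by
      rw [div_le_div_iff₀ (Real.sqrt_pos.2 (by linarith)) hsp]
      have : Real.sqrt (1 + Real.log X) ≤ Real.sqrt 2 * Real.sqrt (Real.log X) := by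
        rw [← Real.sqrt_mul (by norm_num)]
        exact Real.sqrt_le_sqrt (by linarith)
      calc _ ≤ C * X * (Real.sqrt 2 * Real.sqrt (Real.log X)) := by gcongr
        _ = _ := by ring
    have h3 : 0 ≤ Real.sqrt (1 + Real.log Y) * X / Real.sqrt (1 + Real.log X) := by positivity
    linarith
  · push Not at h
    have hXY : (X : ℝ) ≤ Y := by exact_mod_cast h.le
    have h1 := gSum_le A X
    have h2 : (X : ℝ) ≤ Real.sqrt (1 + Real.log Y) * X / Real.sqrt (1 + Real.log X) := by
      rw [le_div_iff₀ hsp, mul_comm]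
      gcongr
    have h3 : 0 ≤ C * Real.sqrt 2 * X / Real.sqrt (1 + Real.log X) := by positivity
    linarith

lemma rep_decomp (A : ℕ) : ∀ n : ℕ, 0 < n → (∃ v w : ℤ, (n : ℤ) = v ^ 2 + A * w ^ 2) →
    ∃ a b : ℕ, 0 < b ∧ n = a * b ^ 2 ∧ gInd A a = 1 := by
  intro n
  induction n using Nat.strong_induction_on with
  | _ n ih =>
    intro hn hrep
    by_cases h : ∀ p, p ∣ n → ¬ BadP A p
    · exact ⟨n, 1, one_pos, by ring, by rw [gInd_apply, if_pos ⟨hn.ne', h⟩]⟩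
    · push Not at h
      obtain ⟨p, hpn, hb⟩ := h
      obtain ⟨v, w, hvw⟩ := hrep
      have : Fact p.Prime := ⟨hb.1⟩
      have hd : (p : ℤ) ∣ v ^ 2 - (-(A : ℤ)) * w ^ 2 := by
        rw [show v ^ 2 - (-(A : ℤ)) * w ^ 2 = n by rw [hvw]; ring]
        exact_mod_cast hpn
      obtain ⟨⟨v', hv⟩, ⟨w', hw⟩⟩ := jacobiSym.prime_dvd_of_eq_neg_one hb.2.2 hd
      have hnp : (n : ℤ) = p ^ 2 * (v' ^ 2 + A * w' ^ 2) := by rw [hvw, hv, hw]; ring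
      have hk0 : 0 ≤ v' ^ 2 + A * w' ^ 2 := by positivity
      obtain ⟨k, hk⟩ := Int.eq_ofNat_of_zero_le hk0
      have hnk : n = p ^ 2 * k := by
        rw [hk] at hnp
        exact_mod_cast hnp
      have hkpos : 0 < k := by
        rcases Nat.eq_zero_or_pos k with h0 | h0
        · subst h0; simp at hnk; omega
        · exact h0
      have hlt : k < n := by
        have := hb.1.two_le
        have h4 : 4 ≤ p ^ 2 := by nlinarith
        rw [hnk]; nlinarith
      obtain ⟨a, b, hb0, hab, hg⟩ := ih k hlt hkpos ⟨v', w', hk.symm⟩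
      exact ⟨a, p * b, Nat.mul_pos hb.1.pos hb0, by rw [hnk, hab]; ring, hg⟩

/-- Upper bound for the number of integers up to `X` represented by `v² + A w²`. -/
theorem landau_upper (A : ℕ) (hA : 0 < A) : ∃ C : ℝ, 0 < C ∧ ∀ X : ℕ, 1 ≤ X →
    ({n : ℕ | 0 < n ∧ n ≤ X ∧ ∃ v w : ℤ, (n : ℤ) = v ^ 2 + A * w ^ 2}.ncard : ℝ) ≤
      C * X / Real.sqrt (1 + Real.log X) := by
  classical
  have : NeZero (4 * A) := ⟨by omega⟩
  obtain ⟨C, hC, hb⟩ := gSum_all A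
  have hsum : Summable (fun b : ℕ => (b : ℝ) ^ (-(3 / 2) : ℝ)) :=
    Real.summable_nat_rpow.2 (by norm_num)
  set Z := ∑' b : ℕ, (b : ℝ) ^ (-(3 / 2) : ℝ) with hZ
  have hZ0 : 0 ≤ Z := tsum_nonneg fun b => by positivity
  refine ⟨C * Real.sqrt 2 * (Z + 1), by positivity, fun X hX => ?_⟩
  have hX1 : (1 : ℝ) ≤ X := by exact_mod_cast hX
  have hlX : 0 ≤ Real.log X := Real.log_nonneg hX1
  let S : ℕ → Finset ℕ := fun Y => (Finset.Ioc 0 Y).filter (fun a => gInd A a = 1)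
  have hS : ∀ Y, ((S Y).card : ℝ) = gSum A Y := by
    intro Y
    rw [gSum, Finset.card_filter]
    push_cast
    apply Finset.sum_congr rfl
    intro a _
    rw [gInd_apply]
    split_ifs <;> simp_all
  have hsub : {n : ℕ | 0 < n ∧ n ≤ X ∧ ∃ v w : ℤ, (n : ℤ) = v ^ 2 + A * w ^ 2} ⊆
      (((Finset.Ioc 0 X).biUnion (fun b => (S (X / b ^ 2)).image (fun a => a * b ^ 2)) :
        Finset ℕ) : Set ℕ) := by
    rintro n ⟨hn0, hnX, hrep⟩
    obtain ⟨a, b, hb0, hab, hg⟩ := rep_decomp A n hn0 hrep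
    have ha0 : 0 < a := by
      rcases Nat.eq_zero_or_pos a with h0 | h0
      · subst h0; simp at hab; omega
      · exact h0
    simp only [Finset.coe_biUnion, Set.mem_iUnion, Finset.mem_coe, Finset.mem_image]
    refine ⟨b, ?_, a, ?_, hab.symm⟩
    · rw [Finset.mem_Ioc]
      refine ⟨hb0, le_trans ?_ hnX⟩
      rw [hab]; nlinarith
    · simp only [S, Finset.mem_filter, Finset.mem_Ioc]
      refine ⟨⟨ha0, ?_⟩, hg⟩
      rw [Nat.le_div_iff_mul_le (by positivity)]
      omega
  have hcard := Set.ncard_le_ncard hsub (Finset.finite_toSet _)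
  rw [Set.ncard_coe_finset] at hcard
  have hcard2 := hcard.trans (Finset.card_biUnion_le.trans
    (Finset.sum_le_sum fun b _ => Finset.card_image_le))
  have hcard3 : ({n : ℕ | 0 < n ∧ n ≤ X ∧ ∃ v w : ℤ, (n : ℤ) = v ^ 2 + A * w ^ 2}.ncard : ℝ) ≤
      ∑ b ∈ Finset.Ioc 0 X, gSum A (X / b ^ 2) := by
    simp_rw [← hS]
    exact_mod_cast hcard2
  refine hcard3.trans ?_
  have hsp : 0 < Real.sqrt (1 + Real.log X) := Real.sqrt_pos.2 (by linarith)
  have hterm : ∀ b ∈ Finset.Ioc 0 X, gSum A (X / b ^ 2) ≤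
      (C * Real.sqrt 2 * X / Real.sqrt (1 + Real.log X)) * (b : ℝ) ^ (-(3 / 2) : ℝ) := by
    intro b hbm
    rw [Finset.mem_Ioc] at hbm
    have hb1 : (1 : ℝ) ≤ b := by exact_mod_cast hbm.1
    rcases Nat.eq_zero_or_pos (X / b ^ 2) with h0 | h0
    · rw [h0]
      have : gSum A 0 = 0 := by simp [gSum]
      rw [this]; positivity
    · set k := X / b ^ 2 with hk
      have hk1 : (1 : ℝ) ≤ k := by exact_mod_cast h0
      have hlk : 0 ≤ Real.log k := Real.log_nonneg hk1
      have hlb : 0 ≤ Real.log b := Real.log_nonneg hb1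
      have hkb : (k : ℝ) * b ^ 2 ≤ X := by
        exact_mod_cast Nat.div_mul_le_self X (b ^ 2)
      have hXk : (X : ℝ) ≤ 2 * k * b ^ 2 := by
        have : X < (k + 1) * b ^ 2 := by
          have := Nat.lt_mul_div_succ X (show 0 < b ^ 2 by have := hbm.1; positivity)
          rw [mul_comm]; exact this
        have h' : (X : ℝ) ≤ (k + 1) * b ^ 2 := by exact_mod_cast this.le
        nlinarith [sq_nonneg (b : ℝ)]
      have hlog : Real.log X ≤ Real.log 2 + Real.log k + 2 * Real.log b := by
        have := Real.log_le_log (by linarith) hXk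
        rw [Real.log_mul (by positivity) (by positivity), Real.log_mul (by positivity)
          (by positivity), Real.log_pow] at this
        exact_mod_cast this
      have hl2 : Real.log 2 ≤ 1 := by
        have := Real.log_two_lt_d9; linarith
      have hlb2 : Real.log b ≤ b - 1 := Real.log_le_sub_one_of_pos (by linarith)
      have hmain : 1 + Real.log X ≤ (1 + Real.log k) * (2 * b) := by nlinarith
      have hsq : Real.sqrt (1 + Real.log X) ≤ Real.sqrt (1 + Real.log k) *
          (Real.sqrt 2 * Real.sqrt b) := by
        rw [← Real.sqrt_mul (by norm_num), ← Real.sqrt_mul (by linarith)]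
        exact Real.sqrt_le_sqrt hmain
      have hpow : (b : ℝ) ^ (-(3 / 2) : ℝ) * b ^ 2 = Real.sqrt b := by
        rw [Real.sqrt_eq_rpow, ← Real.rpow_natCast, ← Real.rpow_add (by linarith)]
        norm_num
      refine (hb k h0).trans ?_
      rw [div_mul_eq_mul_div, div_le_div_iff₀ (Real.sqrt_pos.2 (by linarith)) hsp]
      calc C * k * Real.sqrt (1 + Real.log X)
          ≤ C * k * (Real.sqrt (1 + Real.log k) * (Real.sqrt 2 * Real.sqrt b)) := by gcongr
        _ = C * Real.sqrt 2 * (k * b ^ 2) * (b : ℝ) ^ (-(3 / 2) : ℝ) *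
              Real.sqrt (1 + Real.log k) := by rw [← hpow]; ring
        _ ≤ _ := by gcongr
  refine (Finset.sum_le_sum hterm).trans ?_
  rw [← Finset.mul_sum]
  have h1 := hsum.sum_le_tsum (Finset.Ioc 0 X) (fun b _ => by positivity)
  rw [← hZ] at h1
  calc _ ≤ (C * Real.sqrt 2 * X / Real.sqrt (1 + Real.log X)) * (Z + 1) := by
        gcongr; linarith
    _ = _ := by ring

lemma final_landau (V : Set ℤ) (A : ℕ) (hA : 0 < A) (D K : ℤ) (hD : 0 < D)
    (hV : ∀ m ∈ V, ∃ v w : ℤ, D * m + K = v ^ 2 + A * w ^ 2) :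
    ∃ c : ℝ, 0 < c ∧ ∀ᶠ N : ℕ in atTop,
      ({m : ℤ | (N : ℤ) ≤ m ∧ m ≤ 2 * N ∧ m ∈ V}.ncard : ℝ) ≤ c * N / Real.sqrt (Real.log N) := by
  obtain ⟨C, hC, hb⟩ := landau_upper A hA
  set B : ℕ := (2 * D + |K|).toNat with hB
  have hBz : (B : ℤ) = 2 * D + |K| := Int.toNat_of_nonneg (by positivity)
  have hB1 : 1 ≤ B := by have := abs_nonneg K; omega
  refine ⟨C * B, by positivity, ?_⟩
  filter_upwards [eventually_ge_atTop 2, eventually_gt_atTop K.natAbs] with N hN hNK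
  have hNK' : |K| < N := by rw [Int.abs_eq_natAbs]; exact_mod_cast hNK
  have hKK := abs_le.1 (le_refl |K|)
  have hcard : {m : ℤ | (N : ℤ) ≤ m ∧ m ≤ 2 * N ∧ m ∈ V}.ncard ≤
      {n : ℕ | 0 < n ∧ n ≤ B * N ∧ ∃ v w : ℤ, (n : ℤ) = v ^ 2 + A * w ^ 2}.ncard := by
    have hpos : ∀ m : ℤ, (N : ℤ) ≤ m → 0 < D * m + K := by
      intro m hm
      nlinarith
    have hfin : {n : ℕ | 0 < n ∧ n ≤ B * N ∧ ∃ v w : ℤ, (n : ℤ) = v ^ 2 + A * w ^ 2}.Finite :=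
      (Set.finite_Iic (B * N)).subset (fun n hn => hn.2.1)
    refine Set.ncard_le_ncard_of_injOn (fun m => (D * m + K).toNat) ?_ ?_ hfin
    · rintro m ⟨h1, h2, h3⟩
      have hp := hpos m h1
      have hc : (((D * m + K).toNat : ℕ) : ℤ) = D * m + K := Int.toNat_of_nonneg hp.le
      refine ⟨by omega, ?_, ?_⟩
      · zify
        rw [hc, hBz]
        nlinarith [abs_nonneg K]
      · rw [hc]; exact hV m h3
    · rintro m ⟨h1, _, _⟩ m' ⟨h1', _, _⟩ h
      have hp := hpos m h1
      have hp' := hpos m' h1'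
      have h' : D * m + K = D * m' + K := by
        have h0 : (D * m + K).toNat = (D * m' + K).toNat := h
        omega
      have : D * m = D * m' := by linarith
      exact mul_left_cancel₀ hD.ne' this
  have hBN : 1 ≤ B * N := Nat.mul_pos hB1 (by omega)
  have h1 := hb (B * N) hBN
  have hN1 : (1 : ℝ) < N := by exact_mod_cast hN
  have hB1' : (1 : ℝ) ≤ B := by exact_mod_cast hB1
  have hl : 0 < Real.log N := Real.log_pos hN1
  have hl2 : Real.log N ≤ 1 + Real.log ((B * N : ℕ) : ℝ) := by
    have : Real.log N ≤ Real.log ((B * N : ℕ) : ℝ) := by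
      apply Real.log_le_log (by linarith)
      push_cast
      nlinarith
    linarith
  have hsp := Real.sqrt_pos.2 hl
  calc ({m : ℤ | (N : ℤ) ≤ m ∧ m ≤ 2 * N ∧ m ∈ V}.ncard : ℝ)
      ≤ _ := by exact_mod_cast hcard
    _ ≤ _ := h1
    _ ≤ C * ((B * N : ℕ) : ℝ) / Real.sqrt (Real.log N) := by gcongr
    _ = _ := by push_cast; ring

lemma final_quartic (V : Set ℤ) (D T : ℤ) (f : ℤ → ℤ → ℤ)
    (hV : ∀ m ∈ V, ∃ x u : ℤ, x ^ 4 + u ^ 2 ≤ D * m + T ∧ m = f x u) :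
    ∃ c : ℝ, 0 < c ∧ ∀ᶠ N : ℕ in atTop,
      ({m : ℤ | (N : ℤ) ≤ m ∧ m ≤ 2 * N ∧ m ∈ V}.ncard : ℝ) ≤ c * N / Real.sqrt (Real.log N) := by
  set B : ℕ := (2 * |D| + |T| + 1).toNat with hB
  have hBz : (B : ℤ) = 2 * |D| + |T| + 1 := Int.toNat_of_nonneg (by positivity)
  have hB1 : 1 ≤ B := by have := abs_nonneg D; have := abs_nonneg T; omega
  refine ⟨18 * B, by positivity, ?_⟩
  filter_upwards [eventually_ge_atTop 2] with N hN
  set r := Nat.sqrt (B * N) with hr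
  set q := Nat.sqrt r with hq
  have hBN : 1 ≤ B * N := Nat.mul_pos hB1 (by omega)
  have hr1 : 1 ≤ r := Nat.le_sqrt.2 (by omega)
  have hq1 : 1 ≤ q := Nat.le_sqrt.2 (by omega)
  have hsub : {m : ℤ | (N : ℤ) ≤ m ∧ m ≤ 2 * N ∧ m ∈ V} ⊆
      ((((Finset.Icc (-(q : ℤ)) q) ×ˢ (Finset.Icc (-(r : ℤ)) r)).image
        (fun z => f z.1 z.2) : Finset ℤ) : Set ℤ) := by
    rintro m ⟨h1, h2, h3⟩
    obtain ⟨x, u, hxu, hm⟩ := hV m h3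
    have hbd : x ^ 4 + u ^ 2 ≤ B * N := by
      rw [hBz]
      have e1 : D * m ≤ |D| * m := mul_le_mul_of_nonneg_right (le_abs_self D) (by omega)
      have e2 : |D| * m ≤ |D| * (2 * N) := mul_le_mul_of_nonneg_left h2 (abs_nonneg D)
      have e3 : T ≤ |T| := le_abs_self T
      have e4 : (1 : ℤ) ≤ N := by omega
      nlinarith [abs_nonneg T]
    have hu : u.natAbs ≤ r := by
      rw [hr, Nat.le_sqrt]
      zify
      rw [← sq, sq_abs]
      have : 0 ≤ x ^ 4 := by positivity
      linarith
    have hx : x.natAbs ≤ q := by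
      rw [hq, Nat.le_sqrt, hr, Nat.le_sqrt]
      zify
      have : |x| * |x| * (|x| * |x|) = x ^ 4 := by
        rw [abs_mul_abs_self]; ring
      rw [this]
      have : 0 ≤ u ^ 2 := by positivity
      linarith
    simp only [Finset.coe_image, Set.mem_image, Finset.mem_coe, Finset.mem_product, Finset.mem_Icc]
    exact ⟨(x, u), ⟨⟨by omega, by omega⟩, ⟨by omega, by omega⟩⟩, hm.symm⟩
  have hcard := (Set.ncard_le_ncard hsub (Finset.finite_toSet _))
  rw [Set.ncard_coe_finset] at hcard
  have hcard2 := hcard.trans Finset.card_image_le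
  rw [Finset.card_product, Int.card_Icc, Int.card_Icc] at hcard2
  have hcard3 : {m : ℤ | (N : ℤ) ≤ m ∧ m ≤ 2 * N ∧ m ∈ V}.ncard ≤ (3 * q) * (3 * r) :=
    hcard2.trans (Nat.mul_le_mul (by omega) (by omega))
  have hN1 : (1 : ℝ) < N := by exact_mod_cast hN
  have hB1' : (1 : ℝ) ≤ B := by exact_mod_cast hB1
  have hl : 0 < Real.log N := Real.log_pos hN1
  have hsp := Real.sqrt_pos.2 hl
  set y : ℝ := Real.sqrt (Real.sqrt (B * N)) with hy
  have hBN' : (1 : ℝ) ≤ B * N := by exact_mod_cast hBN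
  have hy2 : y ^ 2 = Real.sqrt (B * N) := Real.sq_sqrt (Real.sqrt_nonneg _)
  have hy4 : y ^ 4 = B * N := by
    rw [show y ^ 4 = (y ^ 2) ^ 2 by ring, hy2, Real.sq_sqrt (by linarith)]
  have hy1 : 1 ≤ y := by
    rw [hy]
    apply Real.le_sqrt_of_sq_le
    apply Real.le_sqrt_of_sq_le
    linarith
  have hry : (r : ℝ) ≤ y ^ 2 := by
    rw [hy2]
    have := Real.nat_sqrt_le_real_sqrt (a := B * N)
    push_cast at this
    exact this
  have hqy : (q : ℝ) ≤ y := by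
    refine (Real.nat_sqrt_le_real_sqrt (a := r)).trans ?_
    rw [hy, ← hy2]
    exact Real.sqrt_le_sqrt hry
  have hlog : Real.sqrt (Real.log N) ≤ 2 * y := by
    apply Real.sqrt_le_iff.2 ⟨by linarith, ?_⟩
    have e1 : Real.log N ≤ Real.log (y ^ 4) := by
      rw [hy4]
      apply Real.log_le_log (by linarith)
      nlinarith
    rw [Real.log_pow] at e1
    have e2 := Real.log_le_sub_one_of_pos (show 0 < y by linarith)
    push_cast at e1
    nlinarith
  rw [le_div_iff₀ hsp]
  have hcard4 : ({m : ℤ | (N : ℤ) ≤ m ∧ m ≤ 2 * N ∧ m ∈ V}.ncard : ℝ) ≤ (3 * q) * (3 * r) := by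
    exact_mod_cast hcard3
  calc _ ≤ (3 * (q : ℝ)) * (3 * r) * (2 * y) := by gcongr
    _ ≤ (3 * y) * (3 * y ^ 2) * (2 * y) := by gcongr
    _ = 18 * y ^ 4 := by ring
    _ = _ := by rw [hy4]; ring

lemma unb4 (e3 e2 e1 e0 M e4 : ℤ) (h : e4 < 0) :
    ∃ x : ℤ, e4 * x ^ 4 + e3 * x ^ 3 + e2 * x ^ 2 + e1 * x + e0 < -M := by
  set k : ℤ := |e3| + |e2| + |e1| + |e0| + |M| + 1 with hk
  have a3 := abs_nonneg e3
  have a2 := abs_nonneg e2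
  have a1 := abs_nonneg e1
  have a0 := abs_nonneg e0
  have aM := abs_nonneg M
  have k1 : 1 ≤ k := by linarith
  have k2 : 1 ≤ k ^ 2 := one_le_pow₀ k1
  have k3 : 1 ≤ k ^ 3 := one_le_pow₀ k1
  have k23 : k ^ 2 ≤ k ^ 3 := pow_le_pow_right₀ k1 (by norm_num)
  have k13 : k ≤ k ^ 3 := le_self_pow₀ k1 (by norm_num)
  refine ⟨k, ?_⟩
  have b4 : e4 * k ^ 4 ≤ -1 * k ^ 4 := mul_le_mul_of_nonneg_right (by omega) (by positivity)
  have b3 : e3 * k ^ 3 ≤ |e3| * k ^ 3 := mul_le_mul_of_nonneg_right (le_abs_self _) (by positivity)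
  have b2 : e2 * k ^ 2 ≤ |e2| * k ^ 3 := mul_le_mul (le_abs_self _) k23 (by positivity) a2
  have b1 : e1 * k ≤ |e1| * k ^ 3 := mul_le_mul (le_abs_self _) k13 (by positivity) a1
  have b0 : e0 ≤ |e0| * k ^ 3 := (le_abs_self _).trans (le_mul_of_one_le_right a0 k3)
  have e : k ^ 4 = (|e3| + |e2| + |e1| + |e0|) * k ^ 3 + (|M| + 1) * k ^ 3 := by
    rw [← add_mul, ← add_assoc, ← hk]; ring
  have f : |M| + 1 ≤ (|M| + 1) * k ^ 3 := le_mul_of_one_le_right (by linarith) k3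
  have g := neg_abs_le M
  have g' := le_abs_self M
  linarith

lemma unb_lower (e3 e2 e1 e0 M : ℤ) (h : e3 < 0 ∨ e3 = 0 ∧ e2 < 0 ∨ e3 = 0 ∧ e2 = 0 ∧ e1 < 0) :
    ∃ x : ℤ, 0 < x ∧ e3 * x ^ 3 + e2 * x ^ 2 + e1 * x + e0 < -M := by
  set k : ℤ := |e2| + |e1| + |e0| + |M| + 1 with hk
  have a2 := abs_nonneg e2
  have a1 := abs_nonneg e1
  have a0 := abs_nonneg e0
  have aM := abs_nonneg M
  have k1 : 1 ≤ k := by linarith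
  have k2 : 1 ≤ k ^ 2 := one_le_pow₀ k1
  have k12 : k ≤ k ^ 2 := le_self_pow₀ k1 (by norm_num)
  have g := neg_abs_le M
  have g' := le_abs_self M
  have l2 := le_abs_self e2
  have l1 := le_abs_self e1
  have l0 := le_abs_self e0
  refine ⟨k, by linarith, ?_⟩
  rcases h with h | ⟨h3, h⟩ | ⟨h3, h2, h⟩
  · have b3 : e3 * k ^ 3 ≤ -1 * k ^ 3 := mul_le_mul_of_nonneg_right (by omega) (by positivity)
    have b2 : e2 * k ^ 2 ≤ |e2| * k ^ 2 := mul_le_mul_of_nonneg_right l2 (by positivity)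
    have b1 : e1 * k ≤ |e1| * k ^ 2 := mul_le_mul l1 k12 (by positivity) a1
    have b0 : e0 ≤ |e0| * k ^ 2 := l0.trans (le_mul_of_one_le_right a0 k2)
    have e : k ^ 3 = (|e2| + |e1| + |e0|) * k ^ 2 + (|M| + 1) * k ^ 2 := by
      rw [← add_mul, ← add_assoc, ← hk]; ring
    have f : |M| + 1 ≤ (|M| + 1) * k ^ 2 := le_mul_of_one_le_right (by linarith) k2
    linarith
  · rw [h3]
    have b2 : e2 * k ^ 2 ≤ -1 * k ^ 2 := mul_le_mul_of_nonneg_right (by omega) (by positivity)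
    have b1 : e1 * k ≤ |e1| * k := mul_le_mul_of_nonneg_right l1 (by positivity)
    have b0 : e0 ≤ |e0| * k := l0.trans (le_mul_of_one_le_right a0 k1)
    have e : k ^ 2 = (|e1| + |e0|) * k + (|e2| + |M| + 1) * k := by
      rw [← add_mul, sq]; congr 1; rw [hk]; ring
    have f : |e2| + |M| + 1 ≤ (|e2| + |M| + 1) * k := le_mul_of_one_le_right (by linarith) k1
    linarith
  · rw [h3, h2]
    have b1 : e1 * k ≤ -1 * k := mul_le_mul_of_nonneg_right (by omega) (by positivity)
    linarith

lemma quartic_lower (e4 e3 e2 e1 e0 : ℤ) (h : 0 < e4) : ∃ T : ℤ, ∀ x : ℤ,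
    x ^ 4 - T ≤ 2 * (e4 * x ^ 4 + e3 * x ^ 3 + e2 * x ^ 2 + e1 * x + e0) := by
  set S := |e3| + |e2| + |e1| with hS
  refine ⟨2 * |e0| + (2 * S) ^ 4, fun x => ?_⟩
  have a3 := abs_nonneg e3
  have a2 := abs_nonneg e2
  have a1 := abs_nonneg e1
  have hS0 : 0 ≤ S := by positivity
  set t := |x| with ht
  have t0 : 0 ≤ t := abs_nonneg x
  have t4 : x ^ 4 = t ^ 4 := by
    rw [ht, show |x| ^ 4 = (|x| ^ 2) ^ 2 by ring, sq_abs]; ring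
  have t23 : t ^ 2 ≤ t ^ 3 := by
    rcases t0.eq_or_lt with h0 | h0
    · rw [← h0]; norm_num
    · exact pow_le_pow_right₀ (by omega) (by norm_num)
  have t13 : t ≤ t ^ 3 := by
    rcases t0.eq_or_lt with h0 | h0
    · rw [← h0]; norm_num
    · exact le_self_pow₀ (by omega) (by norm_num)
  have b4 : t ^ 4 ≤ e4 * x ^ 4 := by
    rw [t4]; exact le_mul_of_one_le_left (by positivity) (by omega)
  have b3 : -(|e3| * t ^ 3) ≤ e3 * x ^ 3 := by
    have := neg_abs_le (e3 * x ^ 3)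
    rwa [abs_mul, abs_pow] at this
  have b2 : -(|e2| * t ^ 3) ≤ e2 * x ^ 2 := by
    have := neg_abs_le (e2 * x ^ 2)
    rw [abs_mul, abs_pow] at this
    have := mul_le_mul_of_nonneg_left t23 a2
    linarith
  have b1 : -(|e1| * t ^ 3) ≤ e1 * x := by
    have := neg_abs_le (e1 * x)
    rw [abs_mul] at this
    have := mul_le_mul_of_nonneg_left t13 a1
    linarith
  have b0 := neg_abs_le e0
  have hmain : 2 * S * t ^ 3 ≤ t ^ 4 + (2 * S) ^ 4 := by
    rcases le_total (2 * S) t with h1 | h1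
    · have : 2 * S * t ^ 3 ≤ t * t ^ 3 := mul_le_mul_of_nonneg_right h1 (by positivity)
      have h2 : 0 ≤ (2 * S) ^ 4 := by positivity
      calc _ ≤ t * t ^ 3 := this
        _ = t ^ 4 := by ring
        _ ≤ _ := by linarith
    · have : t ^ 3 ≤ (2 * S) ^ 3 := pow_le_pow_left₀ t0 h1 3
      have h2 : 2 * S * t ^ 3 ≤ 2 * S * (2 * S) ^ 3 := mul_le_mul_of_nonneg_left this (by linarith)
      have h3 : 0 ≤ t ^ 4 := by positivity
      calc _ ≤ 2 * S * (2 * S) ^ 3 := h2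
        _ = (2 * S) ^ 4 := by ring
        _ ≤ _ := by linarith
  have hS' : S * t ^ 3 = |e3| * t ^ 3 + |e2| * t ^ 3 + |e1| * t ^ 3 := by rw [hS]; ring
  rw [t4] at b4 ⊢
  linarith

/-- The normalised polynomial. -/
def Phi (a b c α β γ δ ε x y : ℤ) : ℤ :=
  a * x ^ 4 + x ^ 2 * (b * x + c * y) + (α * x ^ 2 + β * x * y + γ * y ^ 2) + (δ * x + ε * y)

lemma core_poly (a b c α β γ δ ε : ℤ) (hc : c ≠ 0) :
    (∃ C : ℝ, 0 < C ∧ ∀ᶠ N : ℕ in atTop,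
      ({m : ℤ | (N : ℤ) ≤ m ∧ m ≤ 2 * N ∧ m ∈ {m | ∃ x y, Phi a b c α β γ δ ε x y = m}}.ncard : ℝ)
        ≤ C * N / Real.sqrt (Real.log N)) ∨
    (∀ M : ℤ, ∃ x y : ℤ, Phi a b c α β γ δ ε x y < -M) := by
  rcases lt_trichotomy γ 0 with hγ | hγ | hγ
  · right
    intro M
    obtain ⟨y, _, hy⟩ := unb_lower 0 γ ε 0 M (Or.inr (Or.inl ⟨rfl, hγ⟩))
    refine ⟨0, y, ?_⟩
    simp only [Phi]
    linarith
  · right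
    intro M
    have : ∃ x, c * x ^ 2 + β * x + ε ≠ 0 := by
      by_contra hcon
      push Not at hcon
      have h0 := hcon 0
      have h1 := hcon 1
      have h2 := hcon (-1)
      apply hc
      linarith
    obtain ⟨x, hx⟩ := this
    rcases lt_or_gt_of_ne hx with h | h
    · obtain ⟨y, _, hy⟩ := unb_lower 0 0 (c * x ^ 2 + β * x + ε)
        (a * x ^ 4 + b * x ^ 3 + α * x ^ 2 + δ * x) M (Or.inr (Or.inr ⟨rfl, rfl, h⟩))
      refine ⟨x, y, ?_⟩
      simp only [Phi, hγ]
      linarith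
    · obtain ⟨y, _, hy⟩ := unb_lower 0 0 (-(c * x ^ 2 + β * x + ε))
        (a * x ^ 4 + b * x ^ 3 + α * x ^ 2 + δ * x) M (Or.inr (Or.inr ⟨rfl, rfl, by linarith⟩))
      refine ⟨x, -y, ?_⟩
      simp only [Phi, hγ]
      linarith
  · set e4 := 4 * γ * a - c ^ 2 with he4
    set e3 := 4 * γ * b - 2 * c * β with he3
    set e2 := 4 * γ * α - β ^ 2 - 2 * c * ε with he2
    set e1 := 4 * γ * δ - 2 * β * ε with he1
    set e0 := -ε ^ 2 with he0
    have key : ∀ x y, 4 * γ * Phi a b c α β γ δ ε x y =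
        (2 * γ * y + (c * x ^ 2 + β * x + ε)) ^ 2 +
        (e4 * x ^ 4 + e3 * x ^ 3 + e2 * x ^ 2 + e1 * x + e0) := by
      intro x y
      simp only [Phi, he4, he3, he2, he1, he0]
      ring
    have unb : (∀ M, ∃ x : ℤ, e4 * x ^ 4 + e3 * x ^ 3 + e2 * x ^ 2 + e1 * x + e0 < -M) →
        (∀ M : ℤ, ∃ x y : ℤ, Phi a b c α β γ δ ε x y < -M) := by
      intro h M
      obtain ⟨x, hx⟩ := h (4 * γ * M + 4 * γ ^ 2)
      set l := c * x ^ 2 + β * x + ε with hl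
      refine ⟨x, -(l / (2 * γ)), ?_⟩
      have hk := key x (-(l / (2 * γ)))
      rw [← hl] at hk
      have hmod : 2 * γ * -(l / (2 * γ)) + l = l % (2 * γ) := by
        have := Int.mul_ediv_add_emod l (2 * γ)
        linarith
      rw [hmod] at hk
      have m0 := Int.emod_nonneg l (show 2 * γ ≠ 0 by omega)
      have m1 := Int.emod_lt_of_pos l (show 0 < 2 * γ by omega)
      have msq : (l % (2 * γ)) ^ 2 ≤ (2 * γ) ^ 2 := pow_le_pow_left₀ m0 m1.le 2
      have : 4 * γ * Phi a b c α β γ δ ε x (-(l / (2 * γ))) < 4 * γ * (-M) := by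
        rw [hk]; linarith
      exact lt_of_mul_lt_mul_left this (by omega)
    rcases lt_trichotomy e4 0 with h4 | h4 | h4
    · right
      exact unb (fun M => unb4 e3 e2 e1 e0 M e4 h4)
    · rcases lt_trichotomy e3 0 with h3 | h3 | h3
      · right
        refine unb (fun M => ?_)
        obtain ⟨x, _, hx⟩ := unb_lower e3 e2 e1 e0 M (Or.inl h3)
        exact ⟨x, by rw [h4]; linarith⟩
      · rcases lt_trichotomy e2 0 with h2 | h2 | h2
        · right
          refine unb (fun M => ?_)
          obtain ⟨x, _, hx⟩ := unb_lower e3 e2 e1 e0 M (Or.inr (Or.inl ⟨h3, h2⟩))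
          exact ⟨x, by rw [h4]; linarith⟩
        · rcases lt_trichotomy e1 0 with h1 | h1 | h1
          · right
            refine unb (fun M => ?_)
            obtain ⟨x, _, hx⟩ := unb_lower e3 e2 e1 e0 M (Or.inr (Or.inr ⟨h3, h2, h1⟩))
            exact ⟨x, by rw [h4]; linarith⟩
          · left
            refine final_landau _ 1 one_pos (4 * γ) (-e0) (by omega) ?_
            rintro m ⟨x, y, rfl⟩
            refine ⟨2 * γ * y + (c * x ^ 2 + β * x + ε), 0, ?_⟩
            rw [key, h4, h3, h2, h1]
            ring
          · right
            refine unb (fun M => ?_)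
            obtain ⟨x, _, hx⟩ := unb_lower 0 0 (-e1) e0 M (Or.inr (Or.inr ⟨rfl, rfl, by omega⟩))
            exact ⟨-x, by rw [h4, h3, h2]; linarith⟩
        · left
          refine final_landau _ e2.toNat (by omega) (16 * γ * e2) (e1 ^ 2 - 4 * e2 * e0)
            (by positivity) ?_
          rintro m ⟨x, y, rfl⟩
          refine ⟨2 * e2 * x + e1, 2 * (2 * γ * y + (c * x ^ 2 + β * x + ε)), ?_⟩
          have hk := key x y
          rw [h4, h3] at hk
          rw [Int.toNat_of_nonneg h2.le, show 16 * γ * e2 * Phi a b c α β γ δ ε x y =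
            4 * e2 * (4 * γ * Phi a b c α β γ δ ε x y) by ring, hk]
          ring
      · right
        refine unb (fun M => ?_)
        obtain ⟨x, _, hx⟩ := unb_lower (-e3) e2 (-e1) e0 M (Or.inl (by omega))
        exact ⟨-x, by rw [h4]; linarith⟩
    · left
      obtain ⟨T, hT⟩ := quartic_lower e4 e3 e2 e1 e0 h4
      refine final_quartic _ (8 * γ) T (fun x u => (u ^ 2 +
        (e4 * x ^ 4 + e3 * x ^ 3 + e2 * x ^ 2 + e1 * x + e0)) / (4 * γ)) ?_
      rintro m ⟨x, y, rfl⟩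
      refine ⟨x, 2 * γ * y + (c * x ^ 2 + β * x + ε), ?_, ?_⟩
      · have hk := key x y
        have ht := hT x
        have := sq_nonneg (2 * γ * y + (c * x ^ 2 + β * x + ε))
        rw [show 8 * γ * Phi a b c α β γ δ ε x y = 2 * (4 * γ * Phi a b c α β γ δ ε x y) by ring, hk]
        linarith
      · rw [← key, Int.mul_ediv_cancel_left _ (by omega)]

open MvPolynomial in
lemma lin_form (P : MvPolynomial (Fin 2) ℤ) (hP : P.IsHomogeneous 1) :
    ∃ a b : ℤ, P = C a * X 0 + C b * X 1 := by
  have hsupp : P.support ⊆ {Finsupp.single 0 1, Finsupp.single 1 1} := by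
    intro m hm
    have h : m.degree = 1 := by
      by_contra hne
      exact (mem_support_iff.1 hm) (hP.coeff_eq_zero hne)
    rw [Finsupp.degree_eq_sum, Fin.sum_univ_two] at h
    simp only [Finset.mem_insert, Finset.mem_singleton]
    have h' : (m 0 = 1 ∧ m 1 = 0) ∨ (m 0 = 0 ∧ m 1 = 1) := by omega
    rcases h' with ⟨h0, h1⟩ | ⟨h0, h1⟩
    · left; ext i; fin_cases i <;> simp [h0, h1]
    · right; ext i; fin_cases i <;> simp [h0, h1]
  refine ⟨coeff (Finsupp.single 0 1) P, coeff (Finsupp.single 1 1) P, ?_⟩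
  conv_lhs => rw [P.as_sum]
  rw [Finset.sum_subset hsupp (fun m _ hm => by rw [notMem_support_iff.1 hm, map_zero]),
    Finset.sum_pair (by
      intro h
      have := DFunLike.congr_fun h 0
      simp at this)]
  rw [C_mul_X_eq_monomial, C_mul_X_eq_monomial]

open MvPolynomial in
lemma quad_form (P : MvPolynomial (Fin 2) ℤ) (hP : P.IsHomogeneous 2) :
    ∃ a b c : ℤ, ∀ x y, eval ![x, y] P = a * x ^ 2 + b * x * y + c * y ^ 2 := by
  have hsupp : P.support ⊆ {Finsupp.single 0 2, Finsupp.single 0 1 + Finsupp.single 1 1,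
      Finsupp.single 1 2} := by
    intro m hm
    have h : m.degree = 2 := by
      by_contra hne
      exact (mem_support_iff.1 hm) (hP.coeff_eq_zero hne)
    rw [Finsupp.degree_eq_sum, Fin.sum_univ_two] at h
    simp only [Finset.mem_insert, Finset.mem_singleton]
    have h' : (m 0 = 2 ∧ m 1 = 0) ∨ (m 0 = 1 ∧ m 1 = 1) ∨ (m 0 = 0 ∧ m 1 = 2) := by omega
    rcases h' with ⟨h0, h1⟩ | ⟨h0, h1⟩ | ⟨h0, h1⟩
    · left; ext i; fin_cases i <;> simp [h0, h1]
    · right; left; ext i; fin_cases i <;> simp [h0, h1]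
    · right; right; ext i; fin_cases i <;> simp [h0, h1]
  refine ⟨coeff (Finsupp.single 0 2) P, coeff (Finsupp.single 0 1 + Finsupp.single 1 1) P,
    coeff (Finsupp.single 1 2) P, fun x y => ?_⟩
  rw [eval_eq', Finset.sum_subset hsupp (fun m _ hm => by rw [notMem_support_iff.1 hm, zero_mul]),
    Finset.sum_insert, Finset.sum_pair]
  · simp [Fin.prod_univ_two]
    ring
  · intro h
    have := DFunLike.congr_fun h 0
    simp at this
  · simp only [Finset.mem_insert, Finset.mem_singleton, not_or]
    constructor
    · intro h
      have := DFunLike.congr_fun h 0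
      simp at this
    · intro h
      have := DFunLike.congr_fun h 0
      simp at this

end Helpers

/-- **Proposition 4.2.** Let
`F = a₄ H⁴ + H² G₃ + F₂ + F₁` where `H` is a primitive integral linear form, `a₄ ∈ ℕ`,
`G₃` is an integral linear form with `H ∤ G₃`, and `F₂`, `F₁` are arbitrary integral
forms of degrees 2 and 1.  Then either `#ℛ_F([N,2N]) ≪ N/√(log N)`, or
`inf_{(x,y) ∈ ℤ²} F(x,y) = -∞`. -/
theorem quad_composed_linear_r_two
    (H G3 F2 F1 F : MvPolynomial (Fin 2) ℤ) (a4 : ℤ) (ha4 : 0 < a4)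
    (hH : H.IsHomogeneous 1) (hHprim : IsPrimitiveInt H)
    (hG3 : G3.IsHomogeneous 1) (hHG3 : ¬ H ∣ G3)
    (hF2 : F2.IsHomogeneous 2) (hF1 : F1.IsHomogeneous 1)
    (hF : F = MvPolynomial.C a4 * H ^ 4 + H ^ 2 * G3 + F2 + F1) :
    (∃ c : ℝ, 0 < c ∧ ∀ᶠ N : ℕ in Filter.atTop,
      ({m : ℤ | (N : ℤ) ≤ m ∧ m ≤ 2 * N ∧
          ∃ x y : ℤ, MvPolynomial.eval ![x, y] F = m}.ncard : ℝ)
        ≤ c * N / Real.sqrt (Real.log N)) ∨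
    (∀ M : ℤ, ∃ x y : ℤ, MvPolynomial.eval ![x, y] F < -M) := by
  classical
  obtain ⟨h0, h1, hHe⟩ := lin_form H hH
  obtain ⟨g0, g1, hGe⟩ := lin_form G3 hG3
  obtain ⟨f0, f1, hF1e⟩ := lin_form F1 hF1
  obtain ⟨q0, q1, q2, hF2e⟩ := quad_form F2 hF2
  have hgcd : IsCoprime h0 h1 := by
    rw [Int.isCoprime_iff_gcd_eq_one]
    have hu : IsUnit ((Int.gcd h0 h1 : ℕ) : ℤ) := by
      apply hHprim
      intro m
      rw [hHe, MvPolynomial.coeff_add, MvPolynomial.coeff_C_mul, MvPolynomial.coeff_C_mul]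
      exact dvd_add ((Int.gcd_dvd_left _ _).mul_right _) ((Int.gcd_dvd_right _ _).mul_right _)
    rw [Int.isUnit_iff] at hu
    omega
  obtain ⟨u, v, huv⟩ := hgcd
  have hc : g1 * h0 - g0 * h1 ≠ 0 := by
    intro h
    apply hHG3
    refine ⟨MvPolynomial.C (g0 * u + g1 * v), ?_⟩
    have e0 : g0 = h0 * (g0 * u + g1 * v) := by linear_combination (-g0) * huv - v * h
    have e1 : g1 = h1 * (g0 * u + g1 * v) := by linear_combination (-g1) * huv + u * h
    have e0' := congrArg (MvPolynomial.C (σ := Fin 2)) e0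
    have e1' := congrArg (MvPolynomial.C (σ := Fin 2)) e1
    rw [map_mul] at e0' e1'
    rw [hGe, hHe]
    linear_combination MvPolynomial.X 0 * e0' + MvPolynomial.X 1 * e1'
  have heval : ∀ x y : ℤ, MvPolynomial.eval ![x, y] F =
      a4 * (h0 * x + h1 * y) ^ 4 + (h0 * x + h1 * y) ^ 2 * (g0 * x + g1 * y) +
        (q0 * x ^ 2 + q1 * x * y + q2 * y ^ 2) + (f0 * x + f1 * y) := by
    intro x y
    rw [hF, hHe, hGe, hF1e]
    simp [hF2e]
  have hphi : ∀ X Y : ℤ, MvPolynomial.eval ![u * X - h1 * Y, v * X + h0 * Y] F =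
      Phi a4 (g0 * u + g1 * v) (g1 * h0 - g0 * h1)
        (q0 * u ^ 2 + q1 * u * v + q2 * v ^ 2)
        (-2 * q0 * u * h1 + q1 * (u * h0 - h1 * v) + 2 * q2 * v * h0)
        (q0 * h1 ^ 2 - q1 * h1 * h0 + q2 * h0 ^ 2)
        (f0 * u + f1 * v) (f1 * h0 - f0 * h1) X Y := by
    intro X Y
    rw [heval]
    have e : h0 * (u * X - h1 * Y) + h1 * (v * X + h0 * Y) = X := by
      linear_combination X * huv
    rw [e, Phi]
    ring
  rcases core_poly a4 (g0 * u + g1 * v) (g1 * h0 - g0 * h1)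
        (q0 * u ^ 2 + q1 * u * v + q2 * v ^ 2)
        (-2 * q0 * u * h1 + q1 * (u * h0 - h1 * v) + 2 * q2 * v * h0)
        (q0 * h1 ^ 2 - q1 * h1 * h0 + q2 * h0 ^ 2)
        (f0 * u + f1 * v) (f1 * h0 - f0 * h1) hc with ⟨c, hcpos, hev⟩ | hinf
  · left
    refine ⟨c, hcpos, ?_⟩
    filter_upwards [hev] with N hN
    refine le_trans ?_ hN
    apply le_of_eq
    congr 2
    ext m
    simp only [Set.mem_ofPred_eq]
    refine and_congr_right fun _ => and_congr_right fun _ => ?_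
    constructor
    · rintro ⟨x, y, hxy⟩
      refine ⟨h0 * x + h1 * y, -v * x + u * y, ?_⟩
      rw [← hphi, ← hxy]
      have ex : u * (h0 * x + h1 * y) - h1 * (-v * x + u * y) = x := by
        linear_combination x * huv
      have ey : v * (h0 * x + h1 * y) + h0 * (-v * x + u * y) = y := by
        linear_combination y * huv
      rw [ex, ey]
    · rintro ⟨X, Y, hXY⟩
      exact ⟨_, _, (hphi X Y).trans hXY⟩
  · right
    intro M
    obtain ⟨X, Y, h⟩ := hinf M
    exact ⟨_, _, by rw [hphi X Y]; exact h⟩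
end

section
/- Let F(x,y) = a_4 H(x,y)² + H(x,y) L(x,y) + F_2(x,y) + F_1(x,y) ∈ ℤ[x,y], where H is an indefinite irreducible (over ℚ) primitive integral binary quadratic form, a_4 is a positive integer, L is an integral linear form (possibly zero), and F_2, F_1 are arbitrary integral forms of degrees 2 and 1 (possibly zero). Then either there exists λ > 0 such that #ℛ_F([N,2N]) ≪ N^{1−λ}, or the infimum of F(x,y) over (x,y) ∈ ℤ² is −∞. -/
/-- An integral binary form is indefinite if it takes both positive and negative
values on `ℝ²`. -/
def Indefinite2 (G : MvPolynomial (Fin 2) ℤ) : Prop :=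
  (∃ x y : ℝ, 0 < evalReal G x y) ∧ (∃ x y : ℝ, evalReal G x y < 0)

/-- The image of an integral polynomial in `ℚ[x,y]`. -/
noncomputable def toQ (G : MvPolynomial (Fin 2) ℤ) : MvPolynomial (Fin 2) ℚ :=
  MvPolynomial.map (Int.castRingHom ℚ) G



lemma inhom_aux (θ : ℝ) (hθ : Irrational θ) (w : ℝ) (Y : ℕ) :
    ∃ x y : ℤ, (Y : ℤ) ≤ y ∧ 0 < y ∧ |(x : ℝ) - θ * y - w| * y ≤ 5 := by
  have h1 := hθ.eventually_forall_le_dist_cast_rat_of_den_le Y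
  obtain ⟨ε, hε, hε2⟩ : ∃ ε : ℝ, 0 < ε ∧ ∀ r : ℚ, r.den ≤ Y → ε ≤ dist θ r := by
    have h2 := h1.filter_mono (nhdsWithin_le_nhds (s := Set.Ioi 0))
    obtain ⟨ε, h3, h4⟩ := (h2.and self_mem_nhdsWithin).exists
    exact ⟨ε, h4, h3⟩
  obtain ⟨n, hn⟩ := exists_nat_one_div_lt hε
  obtain ⟨r, hr1, hr2⟩ := Real.exists_rat_abs_sub_le_and_den_le θ (n := n + 1) (Nat.succ_pos n)
  have hd0 : (1 : ℝ) ≤ r.den := by exact_mod_cast r.pos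
  have hn0 : (0:ℝ) < (n : ℝ) + 1 := by positivity
  have hden : Y < r.den := by
    by_contra hc
    have h5 := hε2 r (not_lt.mp hc)
    rw [Real.dist_eq] at h5
    have : 1 / (((n + 1 : ℕ) : ℝ) + 1) / r.den ≤ 1 / ((n : ℝ) + 1) := by
      rw [div_div]
      apply one_div_le_one_div_of_le hn0
      push_cast
      nlinarith
    rw [div_div] at this
    linarith
  have hq : |θ - r| * r.den ^ 2 ≤ 1 := by
    have h6 : (r.den : ℝ) ≤ ((n + 1 : ℕ) : ℝ) := by exact_mod_cast hr2
    rw [le_div_iff₀ (by positivity)] at hr1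
    refine le_trans ?_ hr1
    apply mul_le_mul_of_nonneg_left _ (abs_nonneg _)
    nlinarith
  -- now solve the congruence
  obtain ⟨q, hqdef⟩ : ∃ q : ℤ, q = (r.den : ℤ) := ⟨_, rfl⟩
  obtain ⟨p, hpdef⟩ : ∃ p : ℤ, p = r.num := ⟨_, rfl⟩
  have hqpos : 0 < q := by simp [hqdef, r.pos]
  have hcop : IsCoprime p q := by
    rw [Int.isCoprime_iff_gcd_eq_one]
    have := r.reduced
    simpa [Int.gcd, hqdef, hpdef] using this
  obtain ⟨s, t, hst⟩ := hcop
  set T : ℤ := round (-(q : ℝ) * w) with hT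
  have hT2 : |-(q : ℝ) * w - T| ≤ 1 / 2 := abs_sub_round _
  -- y ≡ s T mod q
  set y : ℤ := (s * T) % q + q with hy
  have hy1 : q ≤ y := by have := Int.emod_nonneg (s*T) hqpos.ne'; omega
  have hy2 : y < 2 * q := by have := Int.emod_lt_of_pos (s*T) hqpos; omega
  obtain ⟨x, hx⟩ : ∃ x : ℤ, p * y - q * x = T := by
    have h7 := Int.emod_add_mul_ediv (s*T) q
    refine ⟨p - p * (s * T / q) - t * T, ?_⟩
    have : y = s * T - q * (s * T / q) + q := by rw [hy]; linarith
    rw [this]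
    linear_combination T * hst
  have hYq : (Y:ℤ) < q := by rw [hqdef]; exact_mod_cast hden
  refine ⟨x, y, by omega, by omega, ?_⟩
  have hqR : (1:ℝ) ≤ q := by exact_mod_cast hqpos
  have hyR1 : (q:ℝ) ≤ y := by exact_mod_cast hy1
  have hyR2 : (y:ℝ) ≤ 2 * q := by exact_mod_cast hy2.le
  have hxR : (p:ℝ) * y - q * x = T := by exact_mod_cast hx
  have hr : (r:ℝ) * q = p := by
    have := Rat.mul_den_eq_num r
    rw [hqdef, hpdef]; exact_mod_cast this
  have hq' : |θ - r| * (q:ℝ) ^ 2 ≤ 1 := by simpa [hqdef] using hq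
  have key : ((x:ℝ) - θ * y - w) * q = (r - θ) * q * y + (-(q:ℝ) * w - T) := by
    rw [← hxR, ← hr]; ring
  have k2 : |(x:ℝ) - θ * y - w| * q ≤ |θ - r| * q * y + 1/2 := by
    calc |(x:ℝ) - θ * y - w| * q = |((x:ℝ) - θ * y - w) * q| := by
          rw [abs_mul, abs_of_pos (by linarith : (0:ℝ) < q)]
      _ ≤ |(r - θ) * q * y| + |-(q:ℝ) * w - T| := by rw [key]; exact abs_add_le _ _
      _ ≤ _ := by
        rw [abs_mul, abs_mul, abs_of_pos (by linarith : (0:ℝ) < q),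
          abs_of_pos (by linarith : (0:ℝ) < y), abs_sub_comm]
        linarith
  have k3 : |θ - r| * q * y ≤ 2 := by
    have : |θ - r| * q * y ≤ |θ - r| * q * (2 * q) := by gcongr
    nlinarith
  have k4 : |(x:ℝ) - θ * y - w| * y ≤ |(x:ℝ) - θ * y - w| * (2 * q) := by gcongr
  linarith

lemma inhom (θ : ℝ) (hθ : Irrational θ) (w : ℝ) (Y : ℕ) (σ : ℝ) (hσ : σ ≠ 0) :
    ∃ x y : ℤ, (Y : ℝ) ≤ |(y : ℝ)| ∧ 1 ≤ |(y : ℝ)| ∧ 0 < σ * y ∧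
      |(x : ℝ) - θ * y - w| * |(y : ℝ)| ≤ 5 := by
  rcases lt_or_gt_of_ne hσ with h | h
  · obtain ⟨x, y, h1, h2, h3⟩ := inhom_aux (-θ) hθ.neg w Y
    have h1' : (Y : ℝ) ≤ y := by exact_mod_cast h1
    have h2' : (1 : ℝ) ≤ y := by exact_mod_cast h2
    have e : |(((-y : ℤ)) : ℝ)| = y := by
      push_cast; rw [abs_neg, abs_of_pos (by linarith)]
    refine ⟨x, -y, by rw [e]; exact h1', by rw [e]; exact h2', by push_cast; nlinarith, ?_⟩
    rw [e]
    convert h3 using 4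
    push_cast; ring
  · obtain ⟨x, y, h1, h2, h3⟩ := inhom_aux θ hθ w Y
    have h1' : (Y : ℝ) ≤ y := by exact_mod_cast h1
    have h2' : (1 : ℝ) ≤ y := by exact_mod_cast h2
    have e : |(y : ℝ)| = y := abs_of_pos (by linarith)
    exact ⟨x, y, by rw [e]; exact h1', by rw [e]; exact h2', by nlinarith, by rw [e]; exact h3⟩
/-- The polynomial in the diagonalizing real coordinates. -/
def Gform (A l l' k α β γ m m' u v : ℝ) : ℝ :=
  (A * (u * v) + l * u + l' * v + k) ^ 2 + α * u ^ 2 + β * (u * v) + γ * v ^ 2 + m * u + m' * v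

lemma mul_le_abs (a b B : ℝ) (h : |b| ≤ B) : a * b ≤ |a| * B := by
  calc a * b ≤ |a * b| := le_abs_self _
    _ = |a| * |b| := abs_mul _ _
    _ ≤ _ := by gcongr

set_option maxHeartbeats 1000000 in
lemma unbounded (θ θ' A l l' k α β γ m m' : ℝ) (hθ : Irrational θ) (hne : θ ≠ θ') (hA : A ≠ 0)
    (h : α < 0 ∨ (α = 0 ∧ β = 0 ∧ m ≠ 0)) (M : ℝ) :
    ∃ x y : ℤ, Gform A l l' k α β γ m m' (x - θ' * y) (x - θ * y) < -M := by
  set δ := θ - θ' with hδ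
  have hδ0 : δ ≠ 0 := sub_ne_zero.mpr hne
  set v0 := -l / A with hv0
  have hv0' : A * v0 + l = 0 := by rw [hv0]; field_simp; ring
  set V := |v0| + 5 with hV
  have hVpos : 0 < V := by positivity
  set B := |A| * (5 * V + 5 * |δ|) + |l'| * V + |k| with hB
  have main : ∀ x y : ℤ, 1 ≤ |(y : ℝ)| → |(x : ℝ) - θ * y - v0| * |(y : ℝ)| ≤ 5 →
      |(x : ℝ) - θ * y| ≤ V ∧
      (A * (((x:ℝ) - θ' * y) * (x - θ * y)) + l * (x - θ' * y) + l' * (x - θ * y) + k) ^ 2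
        ≤ B ^ 2 := by
    intro x y hy hxy
    set e := (x : ℝ) - θ * y - v0 with he
    have hv : (x : ℝ) - θ * y = v0 + e := by rw [he]; ring
    have hu : (x : ℝ) - θ' * y = (v0 + e) + δ * y := by rw [he, hδ]; ring
    have he5 : |e| ≤ 5 := (le_mul_of_one_le_right (abs_nonneg e) hy).trans hxy
    have hvV : |v0 + e| ≤ V := (abs_add_le _ _).trans (by rw [hV]; linarith)
    refine ⟨by rw [hv]; exact hvV, ?_⟩
    rw [hu, hv]
    have e1 : A * ((v0 + e + δ * ↑y) * (v0 + e)) + l * (v0 + e + δ * ↑y) + l' * (v0 + e) + k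
        = A * ((v0 + e) * e + δ * (e * y)) + l' * (v0 + e) + k := by
      linear_combination (v0 + e + δ * y) * hv0'
    rw [e1]
    apply sq_le_sq'
    all_goals
      have : |A * ((v0 + e) * e + δ * (e * y)) + l' * (v0 + e) + k| ≤ B := by
        have t1 : |(v0 + e) * e + δ * (e * y)| ≤ 5 * V + 5 * |δ| := by
          refine (abs_add_le _ _).trans ?_
          rw [abs_mul, abs_mul, abs_mul]
          have : |v0 + e| * |e| ≤ V * 5 := by gcongr
          have : |δ| * (|e| * |(y:ℝ)|) ≤ |δ| * 5 := by gcongr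
          linarith
        have t2 : |A * ((v0 + e) * e + δ * (e * y))| ≤ |A| * (5 * V + 5 * |δ|) := by
          rw [abs_mul]; gcongr
        have t3 : |l' * (v0 + e)| ≤ |l'| * V := by
          rw [abs_mul]; gcongr
        refine (abs_add_le _ _).trans ?_
        have := abs_add_le (A * ((v0 + e) * e + δ * (e * y))) (l' * (v0 + e))
        rw [hB]; linarith
      have := abs_le.mp this
      linarith [this.1, this.2]
  rcases h with hα | ⟨hα, hβ, hm⟩
  · set E := |β| * V + |m| with hE
    set W := |M| + B ^ 2 + |γ| * V ^ 2 + |m'| * V + 1 with hW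
    have hE0 : 0 ≤ E := by positivity
    have hW0 : 0 < W := by positivity
    set R := max 1 ((E + W) / (-α)) with hR
    obtain ⟨Y, hY⟩ := exists_nat_ge ((R + V) / |δ|)
    obtain ⟨x, y, h1, h2, h3, h4⟩ := inhom θ hθ v0 Y 1 one_ne_zero
    obtain ⟨hv, hsq⟩ := main x y h2 h4
    refine ⟨x, y, ?_⟩
    set u := (x : ℝ) - θ' * y with hu
    set v := (x : ℝ) - θ * y with hvdef
    have huR : R ≤ |u| := by
      have : (R + V) ≤ |(y:ℝ)| * |δ| := by
        rw [div_le_iff₀ (by positivity)] at hY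
        exact hY.trans (by gcongr)
      have e2 : δ * y = u - v := by rw [hδ, hu, hvdef]; ring
      have e3 : |δ * y| ≤ |u| + |v| := by rw [e2]; exact abs_sub _ _
      rw [abs_mul] at e3
      linarith
    have hu1 : 1 ≤ |u| := (le_max_left _ _).trans huR
    have hu2 : E + W ≤ |u| * (-α) := by
      have : (E + W) / (-α) ≤ |u| := (le_max_right _ _).trans huR
      rwa [div_le_iff₀ (by linarith)] at this
    have i1 : β * (u * v) ≤ |β| * (|u| * V) := mul_le_abs _ _ _ (by rw [abs_mul]; gcongr)
    have i2 : γ * v ^ 2 ≤ |γ| * V ^ 2 := mul_le_abs _ _ _ (by rw [abs_pow]; gcongr)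
    have i3 : m * u ≤ |m| * |u| := mul_le_abs _ _ _ le_rfl
    have i4 : m' * v ≤ |m'| * V := mul_le_abs _ _ _ hv
    have i5 : α * u ^ 2 + E * |u| ≤ - W := by
      rw [← sq_abs u]
      have t1 : W ≤ |u| * W := le_mul_of_one_le_left hW0.le hu1
      have t2 := mul_le_mul_of_nonneg_left hu2 (abs_nonneg u)
      linarith
    have i6 : M ≤ |M| := le_abs_self _
    unfold Gform
    have : E * |u| = |β| * (|u| * V) + |m| * |u| := by rw [hE]; ring
    linarith
  · set W := |M| + B ^ 2 + |γ| * V ^ 2 + |m'| * V + |m| * V + 1 with hW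
    obtain ⟨Y, hY⟩ := exists_nat_ge (W / (|m| * |δ|))
    obtain ⟨x, y, h1, h2, h3, h4⟩ := inhom θ hθ v0 Y (-(m * δ))
      (neg_ne_zero.mpr (mul_ne_zero hm hδ0))
    obtain ⟨hv, hsq⟩ := main x y h2 h4
    refine ⟨x, y, ?_⟩
    set u := (x : ℝ) - θ' * y with hu
    set v := (x : ℝ) - θ * y with hvdef
    have e2 : u = v + δ * y := by rw [hδ, hu, hvdef]; ring
    have i2 : γ * v ^ 2 ≤ |γ| * V ^ 2 := mul_le_abs _ _ _ (by rw [abs_pow]; gcongr)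
    have i3 : m * v ≤ |m| * V := mul_le_abs _ _ _ hv
    have i4 : m' * v ≤ |m'| * V := mul_le_abs _ _ _ hv
    have i6 : M ≤ |M| := le_abs_self _
    have i7 : W ≤ -(m * δ * y) := by
      have : -(m * δ * y) = |y| * (|m| * |δ|) := by
        rw [show -(m * δ * y) = -(m * δ) * y by ring]
        rw [← abs_of_pos h3, abs_mul, abs_neg, abs_mul]
        push_cast; ring
      rw [this]
      have hp : 0 < |m| * |δ| := by positivity
      rw [div_le_iff₀ hp] at hY
      refine hY.trans ?_
      push_cast
      gcongr
    have i8 : m * u = m * v + m * δ * y := by rw [e2]; ring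
    unfold Gform
    rw [hα, hβ]
    linarith

set_option maxHeartbeats 1000000 in
/-- Growth in the region `|v| ≤ |u|`. -/
lemma growth (A l l' α β γ m m' : ℝ) (hA : A ≠ 0) (hα : 0 < α) :
    ∃ C : ℝ, 0 < C ∧ ∀ u v T : ℝ, 1 ≤ T → |v| ≤ |u| →
      Gform A l l' 0 α β γ m m' u v ≤ T → u ^ 2 ≤ C * T ∧ v ^ 4 ≤ C * T := by
  set E := |β| + |γ| + |m| + |m'| with hE
  have hE0 : 0 ≤ E := by positivity
  have hAp : 0 < |A| := abs_pos.mpr hA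
  set K := 1 + 2 * (|l| + |l'|) / |A| + 8 * E / A ^ 2 with hK
  have hK1 : 1 ≤ K := by
    have : 0 ≤ 2 * (|l| + |l'|) / |A| := by positivity
    have : 0 ≤ 8 * E / A ^ 2 := by positivity
    rw [hK]; linarith
  have hKl : 2 * (|l| + |l'|) ≤ |A| * K := by
    have : 0 ≤ 8 * E / A ^ 2 := by positivity
    have : 2 * (|l| + |l'|) / |A| ≤ K := by rw [hK]; linarith
    rw [div_le_iff₀ hAp] at this; linarith
  have hKE : 8 * E ≤ A ^ 2 * K := by
    have : 0 ≤ 2 * (|l| + |l'|) / |A| := by positivity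
    have : 8 * E / A ^ 2 ≤ K := by rw [hK]; linarith
    rw [div_le_iff₀ (by positivity)] at this; linarith
  set S := (|β| * K + |m|) with hS
  set S' := |γ| * K ^ 2 + |m'| * K with hS'
  have hS0 : 0 ≤ S := by positivity
  have hS'0 : 0 ≤ S' := by positivity
  set C1 := 2 / α * (1 + S' + S ^ 2 / (2 * α)) with hC1
  have hC1p : 0 ≤ C1 := by positivity
  refine ⟨C1 + K ^ 4 + 8 / A ^ 2, by positivity, ?_⟩
  intro u v T hT hvu hG
  have hT0 : 0 ≤ T := by linarith
  have hKT : 0 ≤ K ^ 4 * T := by positivity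
  have hAT : 0 ≤ 8 / A ^ 2 * T := by positivity
  have hCT : 0 ≤ C1 * T := by positivity
  unfold Gform at hG
  rw [add_zero] at hG
  rcases le_total |v| K with hv | hv
  · have i1 : -β * (u * v) ≤ |-β| * (|u| * K) := mul_le_abs _ _ _ (by rw [abs_mul]; gcongr)
    have i2 : -γ * v ^ 2 ≤ |-γ| * K ^ 2 := mul_le_abs _ _ _ (by rw [abs_pow]; gcongr)
    have i3 : -m * u ≤ |-m| * |u| := mul_le_abs _ _ _ le_rfl
    have i4 : -m' * v ≤ |-m'| * K := mul_le_abs _ _ _ hv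
    rw [abs_neg] at i1 i2 i3 i4
    have i5 := sq_nonneg (A * (u * v) + l * u + l' * v)
    have i6 : α * |u| ^ 2 ≤ T + S * |u| + S' := by
      rw [sq_abs, hS, hS']; linarith
    constructor
    · have i7 : S * |u| ≤ α / 2 * |u| ^ 2 + S ^ 2 / (2 * α) := by
        have : 0 ≤ α / 2 * (|u| - S / α) ^ 2 := by positivity
        have e : α / 2 * (|u| - S / α) ^ 2 = α / 2 * |u| ^ 2 - S * |u| + S ^ 2 / (2 * α) := by
          field_simp
          ring
        linarith
      have i8 : α / 2 * |u| ^ 2 ≤ (1 + S' + S ^ 2 / (2 * α)) * T := by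
        have t0 : 0 ≤ S ^ 2 / (2 * α) := by positivity
        have t1 := le_mul_of_one_le_right t0 hT
        have t2 := le_mul_of_one_le_right hS'0 hT
        linarith
      have i9 : u ^ 2 ≤ C1 * T := by
        rw [← sq_abs, hC1]
        have : |u| ^ 2 = 2 / α * (α / 2 * |u| ^ 2) := by field_simp
        rw [this, mul_assoc]
        gcongr
      linarith
    · have : v ^ 4 ≤ K ^ 4 := by
        have : |v| ^ 4 ≤ K ^ 4 := by gcongr
        rwa [← abs_pow, abs_of_nonneg (by positivity)] at this
      have t1 := le_mul_of_one_le_right (pow_pos (by linarith : 0 < K) 4).le hT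
      linarith
  · have hv1 : 1 ≤ |v| := hK1.trans hv
    have hu1 : 1 ≤ |u| := hv1.trans hvu
    have hu2 : |u| ≤ u ^ 2 := by rw [← sq_abs]; exact le_self_pow₀ hu1 (by norm_num)
    have i1 : -β * (u * v) ≤ |-β| * u ^ 2 := mul_le_abs _ _ _ (by
      rw [abs_mul, ← sq_abs u, sq]; gcongr)
    have i2 : -γ * v ^ 2 ≤ |-γ| * u ^ 2 := mul_le_abs _ _ _ (by
      rw [abs_pow, ← sq_abs u]; gcongr)
    have i3 : -m * u ≤ |-m| * u ^ 2 := mul_le_abs _ _ _ hu2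
    have i4 : -m' * v ≤ |-m'| * u ^ 2 := mul_le_abs _ _ _ (hvu.trans hu2)
    rw [abs_neg] at i1 i2 i3 i4
    have i5 : |A| / 2 * (|u| * |v|) ≤ |A * (u * v) + l * u + l' * v| := by
      have t1 : |A * (u * v)| ≤ |A * (u * v) + l * u + l' * v| + |l * u| + |l' * v| := by
        have e : A * (u * v) = (A * (u * v) + l * u + l' * v) - l * u - l' * v := by ring
        calc |A * (u * v)| = |(A * (u * v) + l * u + l' * v) - l * u - l' * v| := by rw [← e]
          _ ≤ |(A * (u * v) + l * u + l' * v) - l * u| + |l' * v| := abs_sub _ _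
          _ ≤ _ := by gcongr; exact abs_sub _ _
      rw [abs_mul, abs_mul, abs_mul, abs_mul] at t1
      have t2 : |l'| * |v| ≤ |l'| * |u| := by gcongr
      have t3 : |u| * (2 * (|l| + |l'|)) ≤ |u| * (|A| * |v|) :=
        mul_le_mul_of_nonneg_left (hKl.trans (by gcongr)) (abs_nonneg u)
      linarith
    have i6 : (|A| / 2 * (|u| * |v|)) ^ 2 ≤ (A * (u * v) + l * u + l' * v) ^ 2 := by
      rw [← sq_abs (A * (u * v) + l * u + l' * v)]
      gcongr
    have i7 : (|A| / 2 * (|u| * |v|)) ^ 2 = A ^ 2 / 4 * (u ^ 2 * v ^ 2) := by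
      rw [mul_pow, div_pow, mul_pow, sq_abs, sq_abs, sq_abs]; norm_num
    have i8 : 8 * E ≤ A ^ 2 * v ^ 2 := by
      refine hKE.trans ?_
      refine mul_le_mul_of_nonneg_left ?_ (sq_nonneg A)
      rw [← sq_abs v]
      exact hv.trans (le_self_pow₀ hv1 (by norm_num))
    have i9 : A ^ 2 / 8 * (u ^ 2 * v ^ 2) ≤ T := by
      have : 0 ≤ α * u ^ 2 := by positivity
      have : u ^ 2 * (8 * E) ≤ u ^ 2 * (A ^ 2 * v ^ 2) := by gcongr
      have : E * u ^ 2 = |β| * u ^ 2 + |γ| * u ^ 2 + |m| * u ^ 2 + |m'| * u ^ 2 := by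
        rw [hE]; ring
      linarith
    have i10 : u ^ 2 * v ^ 2 ≤ 8 / A ^ 2 * T := by
      have : u ^ 2 * v ^ 2 = 8 / A ^ 2 * (A ^ 2 / 8 * (u ^ 2 * v ^ 2)) := by field_simp
      rw [this]; gcongr
    have hv2 : 1 ≤ v ^ 2 := by rw [← sq_abs]; exact one_le_pow₀ hv1
    have hvu2 : v ^ 2 ≤ u ^ 2 := by rw [← sq_abs v, ← sq_abs u]; gcongr
    constructor
    · have t1 := le_mul_of_one_le_right (sq_nonneg u) hv2
      linarith
    · have : v ^ 4 = v ^ 2 * v ^ 2 := by ring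
      have t1 := mul_le_mul_of_nonneg_right hvu2 (sq_nonneg v)
      linarith

lemma icc_card (X : ℝ) (hX : 0 ≤ X) :
    ((Finset.Icc (-⌊X⌋) ⌊X⌋).card : ℝ) ≤ 2 * X + 1 := by
  have h : 0 ≤ ⌊X⌋ := Int.floor_nonneg.mpr hX
  rw [Int.card_Icc]
  have : (((⌊X⌋ + 1 - -⌊X⌋).toNat : ℤ) : ℝ) = 2 * (⌊X⌋ : ℝ) + 1 := by
    rw [Int.toNat_of_nonneg (by omega)]; push_cast; ring
  rw [Int.cast_natCast] at this
  rw [this]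
  have := Int.floor_le X
  linarith

lemma mem_icc_floor (X : ℝ) (z : ℤ) (h : |(z : ℝ)| ≤ X) : z ∈ Finset.Icc (-⌊X⌋) ⌊X⌋ := by
  rw [Finset.mem_Icc, ← abs_le]
  apply Int.le_floor.mpr
  push_cast; exact h

lemma count (θ θ' K : ℝ) (hne : θ ≠ θ') (hK : 0 < K) :
    ∃ c : ℝ, 0 < c ∧ ∀ s : ℝ, 1 ≤ s →
      {p : ℤ × ℤ | |(p.1 : ℝ) - θ' * p.2| ≤ K * s ^ 2 ∧ |(p.1 : ℝ) - θ * p.2| ≤ K * s}.Finite ∧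
      ({p : ℤ × ℤ | |(p.1 : ℝ) - θ' * p.2| ≤ K * s ^ 2 ∧
        |(p.1 : ℝ) - θ * p.2| ≤ K * s}.ncard : ℝ) ≤ c * s ^ 3 := by
  set δ := θ - θ' with hδ
  have hδ0 : δ ≠ 0 := sub_ne_zero.mpr hne
  have hδp : 0 < |δ| := abs_pos.mpr hδ0
  refine ⟨(2 * (2 * K / |δ|) + 1) * (2 * (K + 1) + 1), by positivity, ?_⟩
  intro s hs
  set S := {p : ℤ × ℤ | |(p.1 : ℝ) - θ' * p.2| ≤ K * s ^ 2 ∧ |(p.1 : ℝ) - θ * p.2| ≤ K * s}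
    with hS
  set X := 2 * K / |δ| * s ^ 2 with hX
  set Z := K * s + 1 with hZ
  set T := Finset.Icc (-⌊X⌋) ⌊X⌋ ×ˢ Finset.Icc (-⌊Z⌋) ⌊Z⌋ with hT
  let f : ℤ × ℤ → ℤ × ℤ := fun p => (p.2, ⌊(p.1 : ℝ) - θ * p.2⌋)
  have hmap : ∀ p ∈ S, f p ∈ (T : Set (ℤ × ℤ)) := by
    rintro ⟨x, y⟩ ⟨h1, h2⟩
    simp only at h1 h2
    have hm : f (x, y) ∈ T := by
      rw [hT, Finset.mem_product]
      refine ⟨mem_icc_floor _ _ ?_, mem_icc_floor _ _ ?_⟩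
      · show |(y : ℝ)| ≤ X
        have e : δ * y = ((x:ℝ) - θ' * y) - (x - θ * y) := by rw [hδ]; ring
        have e3 : |δ * y| ≤ K * s ^ 2 + K * s := by
          rw [e]; exact (abs_sub _ _).trans (add_le_add h1 h2)
        rw [abs_mul] at e3
        have : K * s ≤ K * s ^ 2 := by
          gcongr; nlinarith
        rw [hX, div_mul_eq_mul_div, le_div_iff₀ hδp]
        linarith
      · show |((⌊(x : ℝ) - θ * y⌋ : ℤ) : ℝ)| ≤ Z
        have := abs_le.mp h2
        have := Int.floor_le ((x : ℝ) - θ * y)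
        have := Int.lt_floor_add_one ((x : ℝ) - θ * y)
        rw [abs_le, hZ]
        constructor <;> linarith
    exact_mod_cast hm
  have hinj : Set.InjOn f S := by
    rintro ⟨x, y⟩ _ ⟨x', y'⟩ _ h
    simp only [f, Prod.mk.injEq] at h
    obtain ⟨h1, h2⟩ := h
    subst h1
    have e : ∀ z : ℤ, (z : ℝ) - θ * y = (-(θ * y)) + (z : ℝ) := fun z => by ring
    rw [e, e, Int.floor_add_intCast, Int.floor_add_intCast] at h2
    have : x = x' := by omega
    rw [this]
  have hTfin : (T : Set (ℤ × ℤ)).Finite := T.finite_toSet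
  refine ⟨Set.Finite.of_injOn hmap hinj hTfin, ?_⟩
  have h1 := Set.ncard_le_ncard_of_injOn f hmap hinj hTfin
  rw [Set.ncard_coe_finset, hT, Finset.card_product] at h1
  have hs2 : 1 ≤ s ^ 2 := by nlinarith
  calc (S.ncard : ℝ) ≤ ((Finset.Icc (-⌊X⌋) ⌊X⌋).card * (Finset.Icc (-⌊Z⌋) ⌊Z⌋).card : ℕ) := by
        exact_mod_cast h1
    _ ≤ (2 * X + 1) * (2 * Z + 1) := by
        push_cast
        gcongr
        · exact icc_card _ (by positivity)
        · exact icc_card _ (by positivity)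
    _ ≤ ((2 * (2 * K / |δ|) + 1) * s ^ 2) * ((2 * (K + 1) + 1) * s) := by
        have : 0 < s := by linarith
        gcongr
        · rw [hX]; nlinarith
        · rw [hZ]; nlinarith
    _ = _ := by ring
/-- Growth implies few values: the positive case. -/
lemma few_values (θ θ' A l l' α β γ m m' : ℝ) (hne : θ ≠ θ') (hA : A ≠ 0)
    (hα : 0 < α) (hγ : 0 < γ) (F : ℤ → ℤ → ℤ) (a4 : ℤ) (ha4 : 0 < a4)
    (hF : ∀ x y : ℤ, 4 * (a4 : ℝ) * F x y =
      Gform A l l' 0 α β γ m m' (x - θ' * y) (x - θ * y)) :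
    ∃ lam c : ℝ, 0 < lam ∧ 0 < c ∧ ∀ᶠ N : ℕ in Filter.atTop,
      ({m : ℤ | (N : ℤ) ≤ m ∧ m ≤ 2 * N ∧ ∃ x y : ℤ, F x y = m}.ncard : ℝ)
        ≤ c * (N : ℝ) ^ (1 - lam) := by
  obtain ⟨C, hC, hg⟩ := growth A l l' α β γ m m' hA hα
  obtain ⟨C', hC', hg'⟩ := growth A l' l γ β α m' m hA hγ
  have ha4R : (1 : ℝ) ≤ a4 := by exact_mod_cast ha4
  set K := 1 + (C + C') * (8 * a4) with hK
  have hK1 : 1 ≤ K := by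
    have : 0 ≤ (C + C') * (8 * a4) := by positivity
    linarith
  obtain ⟨c, hc, hcount⟩ := count θ θ' K hne (by linarith)
  obtain ⟨c', hc', hcount'⟩ := count θ' θ K hne.symm (by linarith)
  refine ⟨1 / 4, c + c', by norm_num, by positivity, ?_⟩
  filter_upwards [Filter.eventually_ge_atTop 1] with N hN
  have hN1 : (1 : ℝ) ≤ N := by exact_mod_cast hN
  set s : ℝ := (N : ℝ) ^ (1 / 4 : ℝ) with hs
  have hs1 : 1 ≤ s := Real.one_le_rpow hN1 (by norm_num)
  have hs4 : s ^ 4 = N := by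
    rw [hs, ← Real.rpow_natCast, ← Real.rpow_mul (by positivity)]; norm_num
  have hs3 : s ^ 3 = (N : ℝ) ^ (1 - 1 / 4 : ℝ) := by
    rw [hs, ← Real.rpow_natCast, ← Real.rpow_mul (by positivity)]; norm_num
  rw [← hs3]
  obtain ⟨f1, b1⟩ := hcount s hs1
  obtain ⟨f2, b2⟩ := hcount' s hs1
  set S1 := {p : ℤ × ℤ | |(p.1 : ℝ) - θ' * p.2| ≤ K * s ^ 2 ∧ |(p.1 : ℝ) - θ * p.2| ≤ K * s}
  set S2 := {p : ℤ × ℤ | |(p.1 : ℝ) - θ * p.2| ≤ K * s ^ 2 ∧ |(p.1 : ℝ) - θ' * p.2| ≤ K * s}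
  have aux : ∀ D u v : ℝ, 0 < D → D * (8 * a4) ≤ K → u ^ 2 ≤ D * (8 * a4 * N) →
      v ^ 4 ≤ D * (8 * a4 * N) → |u| ≤ K * s ^ 2 ∧ |v| ≤ K * s := by
    intro D u v hD hDK h1 h2
    have hKN : D * (8 * a4 * N) ≤ K * s ^ 4 := by
      rw [hs4, ← mul_assoc]; gcongr
    have hKp : 0 < K := by linarith
    constructor
    · apply abs_le_of_sq_le_sq _ (by positivity)
      refine (h1.trans hKN).trans ?_
      rw [mul_pow, ← pow_mul]
      gcongr
      nlinarith
    · have : |v| ^ 4 ≤ (K * s) ^ 4 := by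
        rw [← abs_pow, abs_of_nonneg (by positivity)]
        refine (h2.trans hKN).trans ?_
        rw [mul_pow]
        gcongr
        exact le_self_pow₀ hK1 (by norm_num)
      exact le_of_pow_le_pow_left₀ (by norm_num) (by positivity) this
  have hsub : {m : ℤ | (N : ℤ) ≤ m ∧ m ≤ 2 * N ∧ ∃ x y : ℤ, F x y = m} ⊆
      (fun p : ℤ × ℤ => F p.1 p.2) '' (S1 ∪ S2) := by
    rintro z ⟨-, hz, x, y, rfl⟩
    refine ⟨(x, y), ?_, rfl⟩
    have hz' : (F x y : ℝ) ≤ 2 * N := by exact_mod_cast hz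
    have hle : Gform A l l' 0 α β γ m m' (x - θ' * y) (x - θ * y) ≤ 8 * a4 * N := by
      rw [← hF]; nlinarith
    have hT : (1 : ℝ) ≤ 8 * a4 * N := by nlinarith
    rcases le_total |(x : ℝ) - θ * y| |(x : ℝ) - θ' * y| with h | h
    · left
      obtain ⟨h1, h2⟩ := hg _ _ _ hT h hle
      exact aux C _ _ hC (by rw [hK]; nlinarith) h1 h2
    · right
      have hle' : Gform A l' l 0 γ β α m' m (x - θ * y) (x - θ' * y) ≤ 8 * a4 * N := by
        refine le_trans (le_of_eq ?_) hle
        unfold Gform; ring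
      obtain ⟨h1, h2⟩ := hg' _ _ _ hT h hle'
      exact aux C' _ _ hC' (by rw [hK]; nlinarith) h1 h2
  have n1 := Set.ncard_le_ncard hsub ((f1.union f2).image _)
  have n2 := Set.ncard_image_le (f := fun p : ℤ × ℤ => F p.1 p.2) (f1.union f2)
  have n3 := Set.ncard_union_le S1 S2
  have n4 := n1.trans (n2.trans n3)
  have n5 : ({m : ℤ | (N : ℤ) ≤ m ∧ m ≤ 2 * N ∧ ∃ x y : ℤ, F x y = m}.ncard : ℝ) ≤
    S1.ncard + S2.ncard := by exact_mod_cast n4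
  linarith

/-- The perfect square case. -/
lemma square_values (F P : ℤ → ℤ → ℤ) (a4 : ℤ) (ha4 : 0 < a4) (k : ℝ)
    (hF : ∀ x y : ℤ, 4 * (a4 : ℝ) * F x y = (P x y + k) ^ 2 - k ^ 2) :
    ∃ lam c : ℝ, 0 < lam ∧ 0 < c ∧ ∀ᶠ N : ℕ in Filter.atTop,
      ({m : ℤ | (N : ℤ) ≤ m ∧ m ≤ 2 * N ∧ ∃ x y : ℤ, F x y = m}.ncard : ℝ)
        ≤ c * (N : ℝ) ^ (1 - lam) := by
  have ha4R : (1 : ℝ) ≤ a4 := by exact_mod_cast ha4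
  set B := (1 + 8 * a4 + k ^ 2) + |k| with hB
  have hB0 : 0 < B := by positivity
  refine ⟨1 / 2, 2 * B + 1, by norm_num, by positivity, ?_⟩
  filter_upwards [Filter.eventually_ge_atTop 1] with N hN
  have hN1 : (1 : ℝ) ≤ N := by exact_mod_cast hN
  set s : ℝ := (N : ℝ) ^ (1 - 1 / 2 : ℝ) with hs
  have hs1 : 1 ≤ s := Real.one_le_rpow hN1 (by norm_num)
  have hs2 : s ^ 2 = N := by
    rw [hs, ← Real.rpow_natCast, ← Real.rpow_mul (by positivity)]; norm_num
  set T := Finset.Icc (-⌊B * s⌋) ⌊B * s⌋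
  have hsub : {m : ℤ | (N : ℤ) ≤ m ∧ m ≤ 2 * N ∧ ∃ x y : ℤ, F x y = m} ⊆
      (fun z : ℤ => ⌊((z + k) ^ 2 - k ^ 2) / (4 * (a4 : ℝ))⌋) '' (T : Set ℤ) := by
    rintro z ⟨-, hz, x, y, rfl⟩
    refine ⟨P x y, ?_, ?_⟩
    · have : P x y ∈ T := by
        apply mem_icc_floor
        have hz' : (F x y : ℝ) ≤ 2 * N := by exact_mod_cast hz
        have h1 : (P x y + k) ^ 2 ≤ ((1 + 8 * a4 + k ^ 2) * s) ^ 2 := by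
          have t1 : (P x y + k) ^ 2 ≤ (8 * a4 + k ^ 2) * s ^ 2 := by
            have := hF x y
            have t2 : k ^ 2 ≤ k ^ 2 * s ^ 2 := by
              rw [hs2]; exact le_mul_of_one_le_right (sq_nonneg k) hN1
            have t3 : 4 * (a4 : ℝ) * F x y ≤ 4 * a4 * (2 * N) := by gcongr
            rw [hs2] at *
            linarith
          rw [mul_pow]
          refine t1.trans ?_
          gcongr
          nlinarith [sq_nonneg k]
        have h2 := abs_le_of_sq_le_sq h1 (by positivity)
        have h3 : |(P x y : ℝ)| ≤ |(P x y : ℝ) + k| + |k| := by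
          have := abs_sub ((P x y : ℝ) + k) k
          rwa [add_sub_cancel_right] at this
        have h4 : |k| ≤ |k| * s := le_mul_of_one_le_right (abs_nonneg k) hs1
        rw [hB, add_mul]
        linarith
      exact_mod_cast this
    · simp only
      rw [← hF, mul_div_cancel_left₀ _ (by positivity), Int.floor_intCast]
  have n1 := Set.ncard_le_ncard hsub (T.finite_toSet.image _)
  have n2 := Set.ncard_image_le (f := fun z : ℤ => ⌊((z + k) ^ 2 - k ^ 2) / (4 * (a4 : ℝ))⌋)
    T.finite_toSet
  rw [Set.ncard_coe_finset] at n2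
  have n3 : ({m : ℤ | (N : ℤ) ≤ m ∧ m ≤ 2 * N ∧ ∃ x y : ℤ, F x y = m}.ncard : ℝ) ≤ T.card := by
    exact_mod_cast n1.trans n2
  have n4 := icc_card (B * s) (by positivity)
  refine n3.trans (n4.trans ?_)
  linarith

lemma irr_lin (θ : ℝ) (hθ : Irrational θ) (p q : ℤ) (h : (p : ℝ) * θ + q = 0) :
    p = 0 ∧ q = 0 := by
  have hp : p = 0 := by
    by_contra hp
    apply hθ
    refine ⟨-q / p, ?_⟩
    have : (p : ℝ) ≠ 0 := by exact_mod_cast hp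
    push_cast
    field_simp
    linarith
  subst hp
  refine ⟨rfl, ?_⟩
  have : (q : ℝ) = 0 := by simpa using h
  exact_mod_cast this

lemma core (a4 a b c l0 l1 f0 f1 f2 g0 g1 : ℤ) (ha4 : 0 < a4) (ha : a ≠ 0) (θ θ' : ℝ)
    (hθ : Irrational θ) (hθ' : Irrational θ') (hne : θ ≠ θ')
    (hsum : (a : ℝ) * (θ + θ') = -b) (hprod : (a : ℝ) * (θ * θ') = c) (F : ℤ → ℤ → ℤ)
    (hF : ∀ x y, F x y = a4 * (a * x ^ 2 + b * x * y + c * y ^ 2) ^ 2 +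
      (a * x ^ 2 + b * x * y + c * y ^ 2) * (l0 * x + l1 * y) +
      (f0 * x ^ 2 + f1 * x * y + f2 * y ^ 2) + (g0 * x + g1 * y)) :
    (∃ lam c : ℝ, 0 < lam ∧ 0 < c ∧ ∀ᶠ N : ℕ in Filter.atTop,
      ({m : ℤ | (N : ℤ) ≤ m ∧ m ≤ 2 * N ∧ ∃ x y : ℤ, F x y = m}.ncard : ℝ)
        ≤ c * (N : ℝ) ^ (1 - lam)) ∨
    (∀ M : ℤ, ∃ x y : ℤ, F x y < -M) := by
  have ha4R : (1 : ℝ) ≤ a4 := by exact_mod_cast ha4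
  have haR : (a : ℝ) ≠ 0 := by exact_mod_cast ha
  obtain ⟨δ, hδ⟩ : ∃ δ, δ = θ - θ' := ⟨_, rfl⟩
  have hδ0 : δ ≠ 0 := by rw [hδ]; exact sub_ne_zero.mpr hne
  have hb : (b : ℝ) = -(a * (θ + θ')) := by linarith
  -- 4 a4 F = (2 a4 H + L)^2 + Q + M
  obtain ⟨q0, hq0⟩ : ∃ q0 : ℤ, q0 = 4 * a4 * f0 - l0 ^ 2 := ⟨_, rfl⟩
  obtain ⟨q1, hq1⟩ : ∃ q1 : ℤ, q1 = 4 * a4 * f1 - 2 * l0 * l1 := ⟨_, rfl⟩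
  obtain ⟨q2, hq2⟩ : ∃ q2 : ℤ, q2 = 4 * a4 * f2 - l1 ^ 2 := ⟨_, rfl⟩
  have hFint : ∀ x y, 4 * a4 * F x y =
      (2 * a4 * (a * x ^ 2 + b * x * y + c * y ^ 2) + (l0 * x + l1 * y)) ^ 2 +
      (q0 * x ^ 2 + q1 * x * y + q2 * y ^ 2) + 4 * a4 * (g0 * x + g1 * y) := by
    intro x y; rw [hF, hq0, hq1, hq2]; ring
  have hFR : ∀ x y : ℤ, 4 * (a4 : ℝ) * F x y =
      (2 * a4 * (a * (((x:ℝ) - θ' * y) * (x - θ * y))) + (l0 * x + l1 * y)) ^ 2 +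
      (q0 * x ^ 2 + q1 * x * y + q2 * y ^ 2) + 4 * a4 * (g0 * x + g1 * y) := by
    intro x y
    have h1 : 4 * (a4 : ℝ) * F x y =
      (2 * a4 * (a * x ^ 2 + b * x * y + c * y ^ 2) + (l0 * x + l1 * y)) ^ 2 +
      (q0 * x ^ 2 + q1 * x * y + q2 * y ^ 2) + 4 * a4 * (g0 * x + g1 * y) := by
      exact_mod_cast hFint x y
    rw [h1, hb, ← hprod]; ring
  have hA : (2 * a4 * a : ℝ) ≠ 0 := by positivity
  -- passing from negative values of `4 a4 F`
  have unb : (∀ M : ℝ, ∃ x y : ℤ, 4 * (a4 : ℝ) * F x y < -M) →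
      (∀ M : ℤ, ∃ x y : ℤ, F x y < -M) := by
    intro h M
    obtain ⟨x, y, hxy⟩ := h (4 * a4 * M)
    refine ⟨x, y, ?_⟩
    have : 4 * (a4 : ℝ) * F x y < 4 * a4 * (-M : ℝ) := by linarith
    have := lt_of_mul_lt_mul_left this (by positivity)
    exact_mod_cast this
  -- the u,v representation
  have hx : ∀ x y : ℝ, x = (θ * (x - θ' * y) - θ' * (x - θ * y)) / δ := by
    intro x y; rw [eq_div_iff hδ0, hδ]; ring
  have hy : ∀ x y : ℝ, y = ((x - θ' * y) - (x - θ * y)) / δ := by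
    intro x y; rw [eq_div_iff hδ0, hδ]; ring
  set α := (q0 * θ ^ 2 + q1 * θ + q2) / δ ^ 2 with hα
  set γ := (q0 * θ' ^ 2 + q1 * θ' + q2) / δ ^ 2 with hγ
  set β := -(2 * q0 * θ * θ' + q1 * (θ + θ') + 2 * q2) / δ ^ 2 with hβ
  set l := (l0 * θ + l1) / δ with hl
  set l' := -(l0 * θ' + l1) / δ with hl'
  set m := 4 * a4 * (g0 * θ + g1) / δ with hm
  set m' := -(4 * a4 * (g0 * θ' + g1)) / δ with hm'
  have hLuv : ∀ x y : ℝ, (l0 * x + l1 * y) = l * (x - θ' * y) + l' * (x - θ * y) := by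
    intro x y; rw [hl, hl']; field_simp; rw [hδ]; ring
  have hMuv : ∀ x y : ℝ, 4 * a4 * (g0 * x + g1 * y) = m * (x - θ' * y) + m' * (x - θ * y) := by
    intro x y; rw [hm, hm']; field_simp; rw [hδ]; ring
  have hQuv : ∀ x y : ℝ, (q0 * x ^ 2 + q1 * x * y + q2 * y ^ 2) =
      α * (x - θ' * y) ^ 2 + β * ((x - θ' * y) * (x - θ * y)) + γ * (x - θ * y) ^ 2 := by
    intro x y; rw [hα, hβ, hγ]; field_simp; rw [hδ]; ring
  have hG : ∀ x y : ℤ, 4 * (a4 : ℝ) * F x y =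
      Gform (2 * a4 * a) l l' 0 α β γ m m' (x - θ' * y) (x - θ * y) := by
    intro x y
    rw [hFR, hLuv, hMuv, hQuv]
    unfold Gform; ring
  have hG' : ∀ x y : ℤ, 4 * (a4 : ℝ) * F x y =
      Gform (2 * a4 * a) l' l 0 γ β α m' m (x - θ * y) (x - θ' * y) := by
    intro x y
    rw [hG]
    unfold Gform; ring
  -- the proportional case
  have prop : q1 * a = q0 * b → q2 * a = q0 * c →
    (∃ lam c : ℝ, 0 < lam ∧ 0 < c ∧ ∀ᶠ N : ℕ in Filter.atTop,
      ({m : ℤ | (N : ℤ) ≤ m ∧ m ≤ 2 * N ∧ ∃ x y : ℤ, F x y = m}.ncard : ℝ)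
        ≤ c * (N : ℝ) ^ (1 - lam)) ∨
    (∀ M : ℤ, ∃ x y : ℤ, F x y < -M) := by
    intro e1 e2
    have e1R : (q1 : ℝ) * a = q0 * b := by exact_mod_cast e1
    have e2R : (q2 : ℝ) * a = q0 * c := by exact_mod_cast e2
    obtain ⟨k, hk⟩ : ∃ k : ℝ, k = q0 / (4 * a4 * a) := ⟨_, rfl⟩
    have hk' : (q0 : ℝ) = 4 * a4 * a * k := by rw [hk]; field_simp
    have hk1 : (q1 : ℝ) = 4 * a4 * b * k := by
      apply mul_right_cancel₀ haR; rw [e1R, hk']; ring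
    have hk2 : (q2 : ℝ) = 4 * a4 * c * k := by
      apply mul_right_cancel₀ haR; rw [e2R, hk']; ring
    -- integral version of the linear form M - 2 k L
    obtain ⟨m0, hm0⟩ : ∃ m0 : ℤ, m0 = 2 * a4 * a * (4 * a4 * g0) - q0 * l0 := ⟨_, rfl⟩
    obtain ⟨m1, hm1⟩ : ∃ m1 : ℤ, m1 = 2 * a4 * a * (4 * a4 * g1) - q0 * l1 := ⟨_, rfl⟩
    have hm0R : (m0 : ℝ) = 2 * a4 * a * (4 * a4 * g0 - 2 * k * l0) := by
      rw [hm0]; push_cast; rw [hk']; ring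
    have hm1R : (m1 : ℝ) = 2 * a4 * a * (4 * a4 * g1 - 2 * k * l1) := by
      rw [hm1]; push_cast; rw [hk']; ring
    by_cases hz : m0 = 0 ∧ m1 = 0
    · left
      have z0 : 4 * a4 * g0 - 2 * k * l0 = 0 := by
        rw [hz.1, Int.cast_zero] at hm0R
        exact (mul_eq_zero.mp hm0R.symm).resolve_left hA
      have z1 : 4 * a4 * g1 - 2 * k * l1 = 0 := by
        rw [hz.2, Int.cast_zero] at hm1R
        exact (mul_eq_zero.mp hm1R.symm).resolve_left hA
      refine square_values F
        (fun x y => 2 * a4 * (a * x ^ 2 + b * x * y + c * y ^ 2) + (l0 * x + l1 * y)) a4 ha4 k ?_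
      intro x y
      have h1 : 4 * (a4 : ℝ) * F x y =
        (2 * a4 * (a * x ^ 2 + b * x * y + c * y ^ 2) + (l0 * x + l1 * y)) ^ 2 +
        (q0 * x ^ 2 + q1 * x * y + q2 * y ^ 2) + 4 * a4 * (g0 * x + g1 * y) := by
        exact_mod_cast hFint x y
      rw [h1]
      push_cast
      rw [hk', hk1, hk2]
      linear_combination x * z0 + y * z1
    · right
      apply unb
      intro M
      have hmne : (m - 2 * k * l) ≠ 0 := by
        intro h0
        apply hz
        apply irr_lin θ hθ
        rw [hm0R, hm1R]
        have : (m - 2 * k * l) * δ = 4 * a4 * (g0 * θ + g1) - 2 * k * (l0 * θ + l1) := by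
          rw [hm, hl]; field_simp
        rw [h0, zero_mul] at this
        linear_combination (-(2 * a4 * a : ℝ)) * this
      obtain ⟨x, y, hxy⟩ := unbounded θ θ' (2 * a4 * a) l l' k 0 0 0 (m - 2 * k * l)
        (m' - 2 * k * l') hθ hne hA (Or.inr ⟨rfl, rfl, hmne⟩) (M - k ^ 2)
      refine ⟨x, y, ?_⟩
      have : 4 * (a4 : ℝ) * F x y = Gform (2 * a4 * a) l l' k 0 0 0 (m - 2 * k * l)
        (m' - 2 * k * l') (x - θ' * y) (x - θ * y) - k ^ 2 := by
        rw [hFR, hLuv, hMuv, hk', hk1, hk2, hb, ← hprod]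
        unfold Gform; ring
      linarith
  have propθ : ∀ t : ℝ, Irrational t → (a : ℝ) * t ^ 2 + b * t + c = 0 →
      q0 * t ^ 2 + q1 * t + q2 = 0 → q1 * a = q0 * b ∧ q2 * a = q0 * c := by
    intro t ht h1 h2
    have := irr_lin t ht (q1 * a - q0 * b) (q2 * a - q0 * c) (by
      push_cast; linear_combination (a : ℝ) * h2 - q0 * h1)
    omega
  have r1 : (a : ℝ) * θ ^ 2 + b * θ + c = 0 := by rw [hb, ← hprod]; ring
  have r2 : (a : ℝ) * θ' ^ 2 + b * θ' + c = 0 := by rw [hb, ← hprod]; ring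
  rcases lt_trichotomy α 0 with h | h | h
  · right
    apply unb
    intro M
    obtain ⟨x, y, hxy⟩ := unbounded θ θ' (2 * a4 * a) l l' 0 α β γ m m' hθ hne hA (Or.inl h) M
    exact ⟨x, y, by rw [hG]; exact hxy⟩
  · rw [hα, div_eq_zero_iff] at h
    obtain ⟨e1, e2⟩ := propθ θ hθ r1 (h.resolve_right (by positivity))
    exact prop e1 e2
  rcases lt_trichotomy γ 0 with h' | h' | h'
  · right
    apply unb
    intro M
    obtain ⟨x, y, hxy⟩ := unbounded θ' θ (2 * a4 * a) l' l 0 γ β α m' m hθ' hne.symm hA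
      (Or.inl h') M
    exact ⟨x, y, by rw [hG']; exact hxy⟩
  · rw [hγ, div_eq_zero_iff] at h'
    obtain ⟨e1, e2⟩ := propθ θ' hθ' r2 (h'.resolve_right (by positivity))
    exact prop e1 e2
  · left
    exact few_values θ θ' (2 * a4 * a) l l' α β γ m m' hne hA h h' F a4 ha4 hG

open MvPolynomial in
lemma form_two (G : MvPolynomial (Fin 2) ℤ) (h : G.IsHomogeneous 2) :
    ∃ a b c : ℤ, G = C a * X 0 ^ 2 + C b * (X 0 * X 1) + C c * X 1 ^ 2 := by
  refine ⟨G.coeff (Finsupp.single 0 2), G.coeff (Finsupp.single 0 1 + Finsupp.single 1 1),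
    G.coeff (Finsupp.single 1 2), ?_⟩
  have e1 : (X 0 * X 1 : MvPolynomial (Fin 2) ℤ) =
      monomial (Finsupp.single 0 1 + Finsupp.single 1 1) 1 := by
    rw [X, X, monomial_mul, one_mul]
  rw [e1, X_pow_eq_monomial, X_pow_eq_monomial]
  simp only [C_mul_monomial, mul_one]
  ext d
  simp only [coeff_add, coeff_monomial]
  by_cases hd : d 0 + d 1 = 2
  · have h3 : d = Finsupp.single 0 2 ∨ d = Finsupp.single 0 1 + Finsupp.single 1 1 ∨
        d = Finsupp.single 1 2 := by
      have : d 0 = 2 ∧ d 1 = 0 ∨ d 0 = 1 ∧ d 1 = 1 ∨ d 0 = 0 ∧ d 1 = 2 := by omega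
      rcases this with h | h | h
      · left; ext i; fin_cases i <;> simp [h.1, h.2]
      · right; left; ext i; fin_cases i <;> simp [h.1, h.2]
      · right; right; ext i; fin_cases i <;> simp [h.1, h.2]
    have n1 : (Finsupp.single 0 2 : Fin 2 →₀ ℕ) ≠ Finsupp.single 0 1 + Finsupp.single 1 1 := by
      intro h; have := DFunLike.congr_fun h 0; simp at this
    have n2 : (Finsupp.single 0 2 : Fin 2 →₀ ℕ) ≠ Finsupp.single 1 2 := by
      intro h; have := DFunLike.congr_fun h 0; simp at this
    have n3 : (Finsupp.single 1 2 : Fin 2 →₀ ℕ) ≠ Finsupp.single 0 1 + Finsupp.single 1 1 := by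
      intro h; have := DFunLike.congr_fun h 0; simp at this
    rcases h3 with rfl | rfl | rfl
    · rw [if_pos rfl, if_neg n1.symm, if_neg n2.symm]; simp
    · rw [if_pos rfl, if_neg n1, if_neg n3]; simp
    · rw [if_pos rfl, if_neg n3.symm, if_neg n2]; simp
  · rw [if_neg, if_neg, if_neg]
    · have := h.coeff_eq_zero (d := d) (by
        rw [Finsupp.degree_eq_sum, Fin.sum_univ_two]; exact hd)
      simpa using this
    all_goals
      rintro rfl
      simp at hd

open MvPolynomial in
lemma form_one (G : MvPolynomial (Fin 2) ℤ) (h : G.IsHomogeneous 1) :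
    ∃ a b : ℤ, G = C a * X 0 + C b * X 1 := by
  refine ⟨G.coeff (Finsupp.single 0 1), G.coeff (Finsupp.single 1 1), ?_⟩
  rw [X, X]
  simp only [C_mul_monomial, mul_one]
  ext d
  simp only [coeff_add, coeff_monomial]
  by_cases hd : d 0 + d 1 = 1
  · have h3 : d = Finsupp.single 0 1 ∨ d = Finsupp.single 1 1 := by
      have : d 0 = 1 ∧ d 1 = 0 ∨ d 0 = 0 ∧ d 1 = 1 := by omega
      rcases this with h | h
      · left; ext i; fin_cases i <;> simp [h.1, h.2]
      · right; ext i; fin_cases i <;> simp [h.1, h.2]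
    have n2 : (Finsupp.single 0 1 : Fin 2 →₀ ℕ) ≠ Finsupp.single 1 1 := by
      intro h; have := DFunLike.congr_fun h 0; simp at this
    rcases h3 with rfl | rfl
    · rw [if_pos rfl, if_neg n2.symm]; simp
    · rw [if_pos rfl, if_neg n2]; simp
  · rw [if_neg, if_neg]
    · have := h.coeff_eq_zero (d := d) (by
        rw [Finsupp.degree_eq_sum, Fin.sum_univ_two]; exact hd)
      simpa using this
    all_goals
      rintro rfl
      simp at hd

lemma not_irr (P R : MvPolynomial (Fin 2) ℚ) (hP : MvPolynomial.eval ![0, 0] P = 0)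
    (hR : MvPolynomial.eval ![0, 0] R = 0) : ¬ Irreducible (P * R) := by
  intro h
  rcases h.isUnit_or_isUnit rfl with hu | hu
  · have := hu.map (MvPolynomial.eval ![0, 0])
    rw [hP] at this; exact not_isUnit_zero this
  · have := hu.map (MvPolynomial.eval ![0, 0])
    rw [hR] at this; exact not_isUnit_zero this

open MvPolynomial in
lemma roots_of_form (a b c : ℤ) (H : MvPolynomial (Fin 2) ℤ)
    (hH : H = C a * X 0 ^ 2 + C b * (X 0 * X 1) + C c * X 1 ^ 2)
    (hirr : Irreducible (toQ H)) (hind : Indefinite2 H) :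
    a ≠ 0 ∧ ∃ θ θ' : ℝ, Irrational θ ∧ Irrational θ' ∧ θ ≠ θ' ∧
      (a : ℝ) * (θ + θ') = -b ∧ (a : ℝ) * (θ * θ') = c := by
  have hQ : toQ H = C (a : ℚ) * X 0 ^ 2 + C (b : ℚ) * (X 0 * X 1) + C (c : ℚ) * X 1 ^ 2 := by
    rw [hH, toQ]; simp
  have hev : ∀ x y : ℝ, evalReal H x y = a * x ^ 2 + b * (x * y) + c * y ^ 2 := by
    intro x y; rw [hH, evalReal]; simp
  have ha : a ≠ 0 := by
    rintro rfl
    have : toQ H = X 1 * (C (b : ℚ) * X 0 + C (c : ℚ) * X 1) := by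
      rw [hQ]; simp; ring
    rw [this] at hirr
    exact not_irr _ _ (by simp) (by simp) hirr
  have haQ : (a : ℚ) ≠ 0 := by exact_mod_cast ha
  have haR : (a : ℝ) ≠ 0 := by exact_mod_cast ha
  -- no rational root
  have hroot : ∀ t : ℝ, (a : ℝ) * t ^ 2 + b * t + c = 0 → Irrational t := by
    rintro t ht ⟨r, rfl⟩
    have hr : (a : ℚ) * r ^ 2 + b * r + c = 0 := by exact_mod_cast ht
    have : toQ H = (X 0 - C r * X 1) * (C (a : ℚ) * X 0 + C (b + a * r : ℚ) * X 1) := by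
      have hc : (c : ℚ) = - (a * r ^ 2 + b * r) := by linarith
      rw [hQ, hc]
      simp only [map_add, map_mul, map_neg, map_pow]
      ring
    rw [this] at hirr
    exact not_irr _ _ (by simp) (by simp) hirr
  refine ⟨ha, ?_⟩
  have hD : (0 : ℝ) < b ^ 2 - 4 * a * c := by
    by_contra hD
    push Not at hD
    obtain ⟨⟨x, y, h1⟩, ⟨x', y', h2⟩⟩ := hind
    rw [hev] at h1 h2
    have key : ∀ x y : ℝ, 0 ≤ 4 * (a : ℝ) * (a * x ^ 2 + b * (x * y) + c * y ^ 2) := by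
      intro x y
      have : 4 * (a : ℝ) * (a * x ^ 2 + b * (x * y) + c * y ^ 2) =
        (2 * a * x + b * y) ^ 2 + (-(b ^ 2 - 4 * a * c)) * y ^ 2 := by ring
      rw [this]
      have : 0 ≤ -((b : ℝ) ^ 2 - 4 * a * c) := by linarith
      positivity
    have k1 := key x y
    have k2 := key x' y'
    rcases lt_or_gt_of_ne haR with h | h
    · nlinarith
    · nlinarith
  set s := Real.sqrt (b ^ 2 - 4 * a * c) with hs
  have hs2 : s ^ 2 = b ^ 2 - 4 * a * c := Real.sq_sqrt hD.le
  have hs0 : 0 < s := Real.sqrt_pos.mpr hD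
  refine ⟨(-b + s) / (2 * a), (-b - s) / (2 * a), ?_, ?_, ?_, ?_, ?_⟩
  · apply hroot
    field_simp
    linear_combination hs2
  · apply hroot
    field_simp
    linear_combination hs2
  · intro h
    rw [div_left_inj' (by positivity)] at h
    linarith
  · field_simp; ring
  · field_simp
    linear_combination -hs2

/-- **Proposition 5.5.** Let
`F = a₄ H² + H L + F₂ + F₁` where `H` is an indefinite irreducible (over `ℚ`) primitive
integral binary quadratic form, `a₄ ∈ ℕ`, `L` is an integral linear form (possibly zero)
and `F₂`, `F₁` are arbitrary integral forms of degrees 2 and 1.  Then either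
`#ℛ_F([N,2N]) ≪ N^{1-λ}` for some `λ > 0`, or `inf_{(x,y) ∈ ℤ²} F(x,y) = -∞`. -/
theorem quad_composed_quadratic
    (H L F2 F1 F : MvPolynomial (Fin 2) ℤ) (a4 : ℤ) (ha4 : 0 < a4)
    (hH : H.IsHomogeneous 2) (hHprim : IsPrimitiveInt H)
    (hHirr : Irreducible (toQ H)) (hHindef : Indefinite2 H)
    (hL : L.IsHomogeneous 1)
    (hF2 : F2.IsHomogeneous 2) (hF1 : F1.IsHomogeneous 1)
    (hF : F = MvPolynomial.C a4 * H ^ 2 + H * L + F2 + F1) :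
    (∃ lam c : ℝ, 0 < lam ∧ 0 < c ∧ ∀ᶠ N : ℕ in Filter.atTop,
      ({m : ℤ | (N : ℤ) ≤ m ∧ m ≤ 2 * N ∧
          ∃ x y : ℤ, MvPolynomial.eval ![x, y] F = m}.ncard : ℝ)
        ≤ c * (N : ℝ) ^ (1 - lam)) ∨
    (∀ M : ℤ, ∃ x y : ℤ, MvPolynomial.eval ![x, y] F < -M) := by
  obtain ⟨a, b, c, hHe⟩ := form_two H hH
  obtain ⟨f0, f1, f2, hF2e⟩ := form_two F2 hF2
  obtain ⟨l0, l1, hLe⟩ := form_one L hL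
  obtain ⟨g0, g1, hF1e⟩ := form_one F1 hF1
  obtain ⟨ha, θ, θ', hθ, hθ', hne, hsum, hprod⟩ := roots_of_form a b c H hHe hHirr hHindef
  refine core a4 a b c l0 l1 f0 f1 f2 g0 g1 ha4 ha θ θ' hθ hθ' hne hsum hprod
    (fun x y => MvPolynomial.eval ![x, y] F) ?_
  intro x y
  rw [hF, hHe, hF2e, hLe, hF1e]
  simp
  ring
end
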